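/- arXiv:1107.2493 — 6 statements merged into one kernel-verified Lean document; each statement's English description precedes it below -/
import Mathlib

section
/- Let R_{G,φ} be a Cantor G-system on a Cantor set X with M(R_{G,φ}) ≠ ∅, and let n be a natural number. Then there is an order isomorphism ψ : D_m(R_{G,φ}) → D_m(R^n_{G,φ}) (a group isomorphism mapping the positive cone onto the positive cone) such that ψ(n·[1_X]) = [1_{X×{1,…,n}}]. In other words, the triples (D_m(R^n_{G,φ}), D_m(R^n_{G,φ})⁺, [1_{X×{1,…,n}}]) and (D_m(R_{G,φ}), D_m(R_{G,φ})⁺, n[1_X]) are isomorphic. -/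
open MeasureTheory
open scoped ENNReal

/-- The group of self-homeomorphisms of a space, under composition. -/
instance homeomorphGroup {X : Type*} [TopologicalSpace X] : Group (X ≃ₜ X) where
  mul f g := g.trans f
  one := Homeomorph.refl X
  inv := Homeomorph.symm
  mul_assoc f g h := rfl
  one_mul f := Homeomorph.ext fun x => rfl
  mul_one f := Homeomorph.ext fun x => rfl
  inv_mul_cancel f := Homeomorph.ext fun x => f.symm_apply_apply x

section Defs

variable {X Y : Type*} [TopologicalSpace X] [TopologicalSpace Y]

/-- The orbit equivalence relation `R_{G,φ}` of an action of `G` on `X` by homeomorphisms. -/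
def orbitRelOf {G : Type*} [Group G] (φ : G →* (X ≃ₜ X)) : Set (X × X) :=
  {p | ∃ g : G, φ g p.1 = p.2}

/-- Freeness of an action by homeomorphisms. -/
def IsFreeAction {G : Type*} [Group G] (φ : G →* (X ≃ₜ X)) : Prop :=
  ∀ g : G, g ≠ 1 → ∀ x : X, φ g x ≠ x

/-- The orbit relation of a single homeomorphism, i.e. of the generated `ℤ`-action. -/
def orbitRelZ (φ : X ≃ₜ X) : Set (X × X) :=
  {p | ∃ n : ℤ, (φ ^ n) p.1 = p.2}

/-- Freeness of the `ℤ`-action generated by a homeomorphism. -/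
def IsFreeZ (φ : X ≃ₜ X) : Prop :=
  ∀ n : ℤ, n ≠ 0 → ∀ x : X, (φ ^ n) x ≠ x

/-- Minimality of an orbit equivalence relation: every class `R[x]` is dense. -/
def IsMinimalRel (R : Set (X × X)) : Prop :=
  ∀ x : X, Dense {y : X | (x, y) ∈ R}

/-- A Borel measure is `R`-invariant if it is invariant under every homeomorphism `h`
with `(x, h x) ∈ R` for all `x`. -/
def IsInvariantMeasure [MeasurableSpace X] (R : Set (X × X)) (μ : Measure X) : Prop :=
  ∀ h : X ≃ₜ X, (∀ x : X, (x, h x) ∈ R) → Measure.map h μ = μ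

/-- Restriction `R|_U = R ∩ (U × U)` of a relation, as a relation on the subtype `U`. -/
def restrictRel (R : Set (X × X)) (U : Set X) : Set (↥U × ↥U) :=
  {p | ((p.1 : X), (p.2 : X)) ∈ R}

/-- `R^n` on `X × {1,…,n}`: `((x,i),(y,j)) ∈ R^n ↔ (x,y) ∈ R`. -/
def finProdRel (R : Set (X × X)) (n : ℕ) : Set ((X × Fin n) × (X × Fin n)) :=
  {p | (p.1.1, p.2.1) ∈ R}

/-- `R^∞` on `X × ℕ`: `((x,i),(y,j)) ∈ R^∞ ↔ (x,y) ∈ R`. -/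
def natProdRel (R : Set (X × X)) : Set ((X × ℕ) × (X × ℕ)) :=
  {p | (p.1.1, p.2.1) ∈ R}

/-- Topological orbit equivalence of two equivalence relations: a homeomorphism `F` of the
underlying spaces with `(F × F)(R₁) = R₂`. -/
def OrbitEquiv (R₁ : Set (X × X)) (R₂ : Set (Y × Y)) : Prop :=
  ∃ F : X ≃ₜ Y, ∀ x y : X, (x, y) ∈ R₁ ↔ (F x, F y) ∈ R₂

/-- The fundamental group `F(R)` of a uniquely ergodic Cantor minimal system, where `μ` is
the unique invariant probability measure: the set of values `(μ × δ)(U)` (with `δ` counting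
measure) over clopen sets `U ⊆ X × {1,…,n}`, `n ∈ ℕ`, such that `R^n|_U` is orbit
equivalent to `R`. -/
noncomputable def fundGroup [MeasurableSpace X] (R : Set (X × X)) (μ : Measure X) : Set ℝ :=
  {l : ℝ | ∃ (n : ℕ) (U : Set (X × Fin n)), IsClopen U ∧
    OrbitEquiv R (restrictRel (finProdRel R n) U) ∧
    l = ((μ.prod Measure.count) U).toReal}

/-- `E_μ`: the additive subgroup of `ℝ` generated by the measures of clopen sets. -/
noncomputable def clopenValueGroup [MeasurableSpace X] (μ : Measure X) : AddSubgroup ℝ :=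
  AddSubgroup.closure {r : ℝ | ∃ V : Set X, IsClopen V ∧ r = (μ V).toReal}

/-- The positive inner multiplier group `IM₊(E)` of an additive subgroup of `ℝ`. -/
def IMplus (E : AddSubgroup ℝ) : Set ℝ :=
  {t : ℝ | 0 < t ∧ t ∈ E ∧ t⁻¹ ∈ E ∧ (fun x => t * x) '' (E : Set ℝ) = (E : Set ℝ)}

end Defs

section Dm

variable {X : Type*} [TopologicalSpace X] [CompactSpace X] [T2Space X]
  [MeasurableSpace X] [OpensMeasurableSpace X]

lemma integrable_intCast_comp (f : C(X, ℤ)) (μ : Measure X) [IsFiniteMeasure μ] :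
    Integrable (fun x => ((f x : ℤ) : ℝ)) μ := by
  have hc : Continuous fun x => ((f x : ℤ) : ℝ) :=
    continuous_of_discreteTopology.comp f.continuous
  simpa [IntegrableOn] using hc.continuousOn.integrableOn_compact (μ := μ) isCompact_univ

/-- The subgroup of `C(X, ℤ)` of functions with zero integral against every `R`-invariant
probability measure; `D_m(R)` is the quotient of `C(X, ℤ)` by this subgroup. -/
def DmKer (R : Set (X × X)) : AddSubgroup C(X, ℤ) where
  carrier := {f | ∀ μ : Measure X, IsProbabilityMeasure μ → IsInvariantMeasure R μ →
    ∫ x, ((f x : ℤ) : ℝ) ∂μ = 0}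
  zero_mem' := by intro μ hp hi; simp
  add_mem' := by
    intro f g hf hg μ hp hi
    have h1 : ∫ x, (((f + g) x : ℤ) : ℝ) ∂μ
        = ∫ x, ((f x : ℤ) : ℝ) ∂μ + ∫ x, ((g x : ℤ) : ℝ) ∂μ := by
      rw [← integral_add (integrable_intCast_comp f μ) (integrable_intCast_comp g μ)]
      congr 1 with x
      push_cast [ContinuousMap.add_apply]
      ring
    rw [h1, hf μ hp hi, hg μ hp hi, add_zero]
  neg_mem' := by
    intro f hf μ hp hi
    have h1 : ∫ x, (((-f) x : ℤ) : ℝ) ∂μ = - ∫ x, ((f x : ℤ) : ℝ) ∂μ := by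
      rw [← integral_neg]
      congr 1 with x
      push_cast [ContinuousMap.neg_apply]
      ring
    rw [h1, hf μ hp hi, neg_zero]

/-- The positive cone `D_m(R)⁺`: classes of nonnegative functions. -/
def DmPos (R : Set (X × X)) : Set (C(X, ℤ) ⧸ DmKer R) :=
  (QuotientAddGroup.mk : C(X, ℤ) → C(X, ℤ) ⧸ DmKer R) '' {f : C(X, ℤ) | ∀ x : X, 0 ≤ f x}

end Dm

/-- A measurable bijection which agrees pointwise with members of a countable family of
measure-preserving bijections is measure preserving. -/
lemma map_eq_self_of_forall_exists_eq {Y K : Type*} [MeasurableSpace Y] [Countable K] [Nonempty K]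
    {ν : Measure Y} (T : K → Y → Y) (hT : ∀ k, MeasurePreserving (T k) ν ν)
    (hinj : ∀ k, Function.Injective (T k)) (h : Y ≃ᵐ Y)
    (hmeas : ∀ k, MeasurableSet {y | h y = T k y}) (hex : ∀ y, ∃ k, h y = T k y) :
    Measure.map h ν = ν := by
  obtain ⟨e, he⟩ := exists_surjective_nat K
  set E : ℕ → Set Y := disjointed fun m => {y | h y = T (e m) y} with hE
  have hEm : ∀ m, MeasurableSet (E m) := fun m => MeasurableSet.disjointed (fun m => hmeas (e m)) m
  have hEd : Pairwise (Function.onFun Disjoint E) := disjoint_disjointed _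
  have hEu : ⋃ m, E m = Set.univ := by
    rw [hE, iUnion_disjointed, Set.eq_univ_iff_forall]
    intro y
    obtain ⟨k, hk⟩ := hex y
    obtain ⟨m, rfl⟩ := he k
    exact Set.mem_iUnion.2 ⟨m, hk⟩
  have hEh : ∀ m, ∀ y ∈ E m, h y = T (e m) y := fun m y hy =>
    disjointed_subset (fun m => {y | h y = T (e m) y}) m hy
  have hIm : ∀ m, MeasurableSet (h '' E m) := fun m => (h.measurableSet_image).2 (hEm m)
  have hId : Pairwise (Function.onFun Disjoint fun m => h '' E m) := fun a b hab =>
    (Set.disjoint_image_iff h.injective).2 (hEd hab)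
  have hIu : ⋃ m, h '' E m = Set.univ := by
    rw [← Set.image_iUnion, hEu, Set.image_univ, h.surjective.range_eq]
  ext A hA
  have key : ∀ m, h ⁻¹' A ∩ E m = T (e m) ⁻¹' (A ∩ h '' E m) := by
    intro m
    ext y
    constructor
    · rintro ⟨hy, hym⟩
      have := hEh m y hym
      exact ⟨by simpa [← this] using hy, y, hym, this⟩
    · rintro ⟨hy, z, hz, hzy⟩
      have hzy' := hinj (e m) ((hEh m z hz).symm.trans hzy)
      subst hzy'
      exact ⟨by simpa [hzy] using hy, hz⟩
  rw [h.map_apply]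
  calc ν (h ⁻¹' A) = ∑' m, ν (h ⁻¹' A ∩ E m) := by
        rw [← measure_iUnion (fun a b hab => (hEd hab).mono Set.inter_subset_right
          Set.inter_subset_right) fun m => (h.measurable hA).inter (hEm m),
          ← Set.inter_iUnion, hEu, Set.inter_univ]
    _ = ∑' m, ν (A ∩ h '' E m) := by
        congr 1 with m
        rw [key m, (hT (e m)).measure_preimage (hA.inter (hIm m)).nullMeasurableSet]
    _ = ν A := by
        rw [← measure_iUnion (fun a b hab => (hId hab).mono Set.inter_subset_right
          Set.inter_subset_right) fun m => hA.inter (hIm m),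
          ← Set.inter_iUnion, hIu, Set.inter_univ]

/-- Summation over the fibres of `X × Fin n → X`, as a map `C(X × Fin n, ℤ) → C(X, ℤ)`. -/
def fibreSum (X : Type*) [TopologicalSpace X] (n : ℕ) : C(X × Fin n, ℤ) →+ C(X, ℤ) where
  toFun f := ⟨fun x => ∑ i, f (x, i), by fun_prop⟩
  map_zero' := by ext x; simp
  map_add' f g := by ext x; simp [Finset.sum_add_distrib]

/-- Extension by zero of a function on `X`, viewed on the sheet `X × {i}`. -/
def sheetExtend {X : Type*} [TopologicalSpace X] {n : ℕ} (i : Fin n) (f : C(X, ℤ)) :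
    C(X × Fin n, ℤ) where
  toFun p := f p.1 * (if p.2 = i then 1 else 0)
  continuous_toFun := (f.continuous.comp continuous_fst).mul
    ((continuous_of_discreteTopology (f := fun j : Fin n => if j = i then (1 : ℤ) else 0)).comp
      continuous_snd)

lemma fibreSum_sheetExtend {X : Type*} [TopologicalSpace X] {n : ℕ} (i : Fin n) (f : C(X, ℤ)) :
    fibreSum X n (sheetExtend i f) = f := by
  ext x
  simp [fibreSum, sheetExtend]

lemma orbitRelOf_refl {G X : Type*} [Group G] [TopologicalSpace X] (φ : G →* (X ≃ₜ X)) (x : X) :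
    (x, x) ∈ orbitRelOf φ :=
  ⟨1, by rw [map_one]; rfl⟩

section Invariance

variable {X : Type*} [TopologicalSpace X] [MeasurableSpace X]

/-- The first marginal of an `R^n`-invariant measure is `R`-invariant. -/
lemma IsInvariantMeasure.map_fst [BorelSpace X] [SecondCountableTopology X]
    {R : Set (X × X)} {n : ℕ}
    {ν : Measure (X × Fin n)}
    (hν : IsInvariantMeasure (finProdRel R n) ν) : IsInvariantMeasure R (ν.map Prod.fst) := by
  intro h hh
  have := hν (h.prodCongr (Homeomorph.refl _)) fun p => hh p.1
  conv_rhs => rw [← this]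
  rw [Measure.map_map h.measurable measurable_fst,
    Measure.map_map measurable_fst (Homeomorph.measurable _)]
  rfl

/-- The product of an `R`-invariant measure with a permutation-invariant measure on `Fin n` is
`R^n`-invariant, for the orbit relation `R` of a countable group. -/
lemma IsInvariantMeasure.prod [BorelSpace X] [SecondCountableTopology X] [T2Space X]
    {G : Type*} [Group G] [Countable G] {φ : G →* (X ≃ₜ X)} {n : ℕ} {μ : Measure X} [SFinite μ]
    (hμ : IsInvariantMeasure (orbitRelOf φ) μ) {ρ : Measure (Fin n)} [SFinite ρ]
    (hρ : ∀ σ : Equiv.Perm (Fin n), ρ.map σ = ρ) :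
    IsInvariantMeasure (finProdRel (orbitRelOf φ) n) (μ.prod ρ) := by
  intro h hh
  refine map_eq_self_of_forall_exists_eq
    (fun (k : G × Equiv.Perm (Fin n)) => Prod.map (φ k.1) k.2) (fun k => ?_) (fun k => ?_)
    h.toMeasurableEquiv (fun k => ?_) fun y => ?_
  · exact MeasurePreserving.prod ⟨(φ k.1).measurable, hμ _ fun x => ⟨k.1, rfl⟩⟩
      ⟨measurable_of_finite _, hρ k.2⟩
  · exact (φ k.1).injective.prodMap k.2.injective
  · exact (isClosed_eq h.continuous
      ((φ k.1).continuous.prodMap continuous_of_discreteTopology)).measurableSet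
  · obtain ⟨g, hg⟩ := hh y
    exact ⟨(g, Equiv.swap y.2 (h y).2), Prod.ext hg.symm (Equiv.swap_apply_left _ _).symm⟩

lemma card_mul_integral_eq_integral_fibreSum [CompactSpace X] [T2Space X] [BorelSpace X]
    [SecondCountableTopology X] {R : Set (X × X)} (hR : ∀ x, (x, x) ∈ R) {n : ℕ}
    {ν : Measure (X × Fin n)} [IsFiniteMeasure ν]
    (hν : IsInvariantMeasure (finProdRel R n) ν) (f : C(X × Fin n, ℤ)) :
    (n : ℝ) * ∫ p, (f p : ℝ) ∂ν = ∫ x, (fibreSum X n f x : ℝ) ∂(ν.map Prod.fst) := by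
  rcases Nat.eq_zero_or_pos n with rfl | hn
  · simp [fibreSum]
  have : NeZero n := ⟨hn.ne'⟩
  let τ (c : Fin n) : X × Fin n ≃ₜ X × Fin n :=
    (Homeomorph.refl X).prodCongr (Equiv.addRight c).toHomeomorphOfDiscrete
  have hτ : ∀ c, ∫ p, (f (τ c p) : ℝ) ∂ν = ∫ p, (f p : ℝ) ∂ν := fun c => by
    conv_rhs => rw [← hν (τ c) fun p => hR p.1]
    exact ((τ c).measurableEmbedding.integral_map (fun p => (f p : ℝ))).symm
  rw [integral_map measurable_fst.aemeasurable
    (integrable_intCast_comp (fibreSum X n f) _).aestronglyMeasurable]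
  have hsum : ∀ p : X × Fin n, (fibreSum X n f p.1 : ℝ) = ∑ c, (f (τ c p) : ℝ) := fun p => by
    simp only [fibreSum, AddMonoidHom.coe_mk, ZeroHom.coe_mk, ContinuousMap.coe_mk, Int.cast_sum]
    exact (Equiv.sum_comp (Equiv.addLeft p.2) fun i => (f (p.1, i) : ℝ)).symm
  simp_rw [hsum]
  have hint : ∀ c, Integrable (fun p => (f (τ c p) : ℝ)) ν := fun c =>
    integrable_intCast_comp (f.comp ⟨τ c, (τ c).continuous⟩) ν
  rw [integral_finsetSum _ fun c _ => hint c]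
  simp [hτ]

/-- A function on `X × Fin n` is null for `R^n` iff its sum over the fibres is null for `R`. -/
lemma mem_DmKer_finProdRel_iff [CompactSpace X] [T2Space X] [BorelSpace X]
    [SecondCountableTopology X] {G : Type*} [Group G] [Countable G] (φ : G →* (X ≃ₜ X))
    {n : ℕ} (hn : 0 < n) (f : C(X × Fin n, ℤ)) :
    f ∈ DmKer (finProdRel (orbitRelOf φ) n) ↔ fibreSum X n f ∈ DmKer (orbitRelOf φ) := by
  constructor
  · intro hf μ hp hi
    let ρ : Measure (Fin n) := (n : ℝ≥0∞)⁻¹ • Measure.count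
    have hρ : IsProbabilityMeasure ρ := ⟨by
      simp [ρ, Measure.count_univ, ENNReal.inv_mul_cancel, hn.ne']⟩
    have hρσ : ∀ σ : Equiv.Perm (Fin n), ρ.map σ = ρ := fun σ => by
      ext s hs
      rw [Measure.map_apply (measurable_of_finite _) hs]
      simp [ρ, Measure.count_apply, Set.encard_preimage_of_bijective σ.bijective]
    have hν := hi.prod hρσ
    have := card_mul_integral_eq_integral_fibreSum (orbitRelOf_refl φ) hν f
    rw [hf _ inferInstance hν, mul_zero] at this
    simpa using this.symm
  · intro hf ν hp hi
    have := card_mul_integral_eq_integral_fibreSum (orbitRelOf_refl φ) hi f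
    rw [hf _ (Measure.isProbabilityMeasure_map measurable_fst.aemeasurable) hi.map_fst] at this
    exact (mul_eq_zero.1 this).resolve_left (by exact_mod_cast hn.ne')

end Invariance

/-- For a Cantor `G`-system with `M(R) ≠ ∅` and `n ∈ ℕ`, the triples
`(D_m(R^n), D_m(R^n)⁺, [1_(X×{1,…,n})])` and `(D_m(R), D_m(R)⁺, n[1_X])` are isomorphic. -/
theorem statement0 {G : Type*} [Group G] [Countable G] {X : Type*} [TopologicalSpace X] [CompactSpace X]
    [TopologicalSpace.MetrizableSpace X] [TotallyDisconnectedSpace X] [Nonempty X]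
    [MeasurableSpace X] [BorelSpace X]
    (hperf : Perfect (Set.univ : Set X))
    (φ : G →* (X ≃ₜ X)) (hfree : IsFreeAction φ)
    (hM : ∃ μ : Measure X, IsProbabilityMeasure μ ∧ IsInvariantMeasure (orbitRelOf φ) μ)
    (n : ℕ) (hn : 0 < n) :
    ∃ ψ : (C(X, ℤ) ⧸ DmKer (orbitRelOf φ)) ≃+
        (C(X × Fin n, ℤ) ⧸ DmKer (finProdRel (orbitRelOf φ) n)),
      (⇑ψ '' DmPos (orbitRelOf φ) = DmPos (finProdRel (orbitRelOf φ) n)) ∧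
      ψ ((n : ℤ) • (QuotientAddGroup.mk (1 : C(X, ℤ))))
        = QuotientAddGroup.mk (1 : C(X × Fin n, ℤ)) := by
  let F := QuotientAddGroup.map (DmKer (finProdRel (orbitRelOf φ) n)) (DmKer (orbitRelOf φ))
    (fibreSum X n) fun f hf => (mem_DmKer_finProdRel_iff φ hn f).1 hf
  have hFmk : ∀ f : C(X × Fin n, ℤ), F (QuotientAddGroup.mk f) =
      QuotientAddGroup.mk (fibreSum X n f) := fun f => rfl
  have hinj : Function.Injective F := by
    rw [injective_iff_map_eq_zero]
    intro a
    induction a using QuotientAddGroup.induction_on with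
    | H f =>
      intro hf
      rw [hFmk, QuotientAddGroup.eq_zero_iff] at hf
      exact (QuotientAddGroup.eq_zero_iff f).2 ((mem_DmKer_finProdRel_iff φ hn f).2 hf)
  have hsurj : Function.Surjective F := by
    intro a
    induction a using QuotientAddGroup.induction_on with
    | H f => exact ⟨QuotientAddGroup.mk (sheetExtend ⟨0, hn⟩ f), by
        rw [hFmk, fibreSum_sheetExtend]⟩
  let Ψ := AddEquiv.ofBijective F ⟨hinj, hsurj⟩
  refine ⟨Ψ.symm, ?_, ?_⟩
  · ext a
    constructor
    · rintro ⟨_, ⟨f, hf, rfl⟩, rfl⟩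
      refine ⟨sheetExtend ⟨0, hn⟩ f, fun p => mul_nonneg (hf p.1) (by split_ifs <;> simp), ?_⟩
      rw [AddEquiv.eq_symm_apply]
      exact (hFmk _).trans (by rw [fibreSum_sheetExtend])
    · rintro ⟨f, hf, rfl⟩
      exact ⟨QuotientAddGroup.mk (fibreSum X n f),
        ⟨fibreSum X n f, fun x => (Finset.sum_nonneg fun i _ => hf (x, i) :
          (0 : ℤ) ≤ ∑ i, f (x, i)), rfl⟩,
        (AddEquiv.symm_apply_eq Ψ).2 (hFmk f).symm⟩
  · rw [AddEquiv.symm_apply_eq]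
    refine Eq.trans ?_ (hFmk 1).symm
    rw [← QuotientAddGroup.mk_zsmul]
    congr 1
    ext x
    simp [fibreSum]
end

section
/- Let R_{G,φ} be a Cantor minimal G-system on a Cantor set X and let U be a nonempty clopen subset of X. If μ₁ and μ₂ are R_{G,φ}-invariant Borel probability measures on X whose restrictions to U coincide (μ₁(W) = μ₂(W) for every Borel set W ⊆ U), then μ₁ = μ₂. -/
open MeasureTheory
open scoped ENNReal

/-- For a Cantor minimal `G`-system and a nonempty clopen `U ⊆ X`, two
invariant Borel probability measures which agree on all Borel subsets of `U` are equal. -/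
theorem statement1 {G : Type*} [Group G] [Countable G] {X : Type*} [TopologicalSpace X] [CompactSpace X]
    [TopologicalSpace.MetrizableSpace X] [TotallyDisconnectedSpace X] [Nonempty X]
    [MeasurableSpace X] [BorelSpace X]
    (hperf : Perfect (Set.univ : Set X))
    (φ : G →* (X ≃ₜ X)) (hfree : IsFreeAction φ) (hmin : IsMinimalRel (orbitRelOf φ))
    (U : Set X) (hU : IsClopen U) (hUne : U.Nonempty)
    (μ₁ μ₂ : Measure X) [IsProbabilityMeasure μ₁] [IsProbabilityMeasure μ₂]
    (h₁ : IsInvariantMeasure (orbitRelOf φ) μ₁) (h₂ : IsInvariantMeasure (orbitRelOf φ) μ₂)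
    (hres : ∀ W : Set X, W ⊆ U → MeasurableSet W → μ₁ W = μ₂ W) :
    μ₁ = μ₂ := by
  have hcover : ⋃ g : G, φ g ⁻¹' U = Set.univ := by
    refine Set.eq_univ_of_forall fun x => ?_
    obtain ⟨y, hyU, g, hg⟩ := (hmin x).inter_open_nonempty U hU.isOpen hUne
    exact Set.mem_iUnion.2 ⟨g, by rwa [Set.mem_preimage, show φ g x = y from hg]⟩
  refine (Measure.ext_iff_of_iUnion_eq_univ hcover).2 fun g => ?_
  have hU_eq : μ₁.restrict U = μ₂.restrict U := by
    ext W hW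
    rw [Measure.restrict_apply hW, Measure.restrict_apply hW]
    exact hres _ Set.inter_subset_right (hW.inter hU.isOpen.measurableSet)
  have hinv (μ : Measure X) (h : IsInvariantMeasure (orbitRelOf φ) μ) :
      Measure.map (φ g) (μ.restrict (φ g ⁻¹' U)) = μ.restrict U := by
    rw [← Measure.restrict_map (φ g).measurable hU.isOpen.measurableSet,
      h (φ g) fun x => ⟨g, rfl⟩]
  refine (φ g).measurableEmbedding.map_injective ?_
  rw [hinv μ₁ h₁, hinv μ₂ h₂, hU_eq]
end

section
/- Let R_{G,φ} be a Cantor minimal G-system on a Cantor set X and let U be a nonempty clopen subset of X. For every finite Borel measure ν on U that is invariant under every homeomorphism h of U satisfying (x, h(x)) ∈ R_{G,φ}|_U for all x ∈ U, there exists an R_{G,φ}-invariant Borel measure μ on X whose restriction to U equals ν. Hence the restriction map π(μ) = μ|_U is a bijection from the R_{G,φ}-invariant Borel probability measures onto the corresponding invariant measures of R_{G,φ}|_U arising as such restrictions. -/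
open MeasureTheory
open scoped ENNReal

section Extension

variable {G X : Type*} [Group G] [TopologicalSpace X]

theorem hom_mul_apply (φ : G →* (X ≃ₜ X)) (g k : G) (x : X) :
    φ (g * k) x = φ g (φ k x) := by
  rw [map_mul]; rfl

theorem hom_one_apply (φ : G →* (X ≃ₜ X)) (x : X) : φ 1 x = x := by
  rw [map_one]; rfl

theorem hom_inv_apply_self (φ : G →* (X ≃ₜ X)) (g : G) (x : X) : φ g⁻¹ (φ g x) = x := by
  rw [← hom_mul_apply, inv_mul_cancel, hom_one_apply]

theorem hom_apply_inv_self (φ : G →* (X ≃ₜ X)) (g : G) (x : X) : φ g (φ g⁻¹ x) = x := by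
  rw [← hom_mul_apply, mul_inv_cancel, hom_one_apply]

theorem restrict_eq_of_forall_subset {Y : Type*} [MeasurableSpace Y] {μ ν : Measure Y} {S : Set Y}
    (hS : MeasurableSet S) (h : ∀ B, MeasurableSet B → B ⊆ S → μ B = ν B) :
    μ.restrict S = ν.restrict S := by
  ext B hB
  rw [Measure.restrict_apply hB, Measure.restrict_apply hB]
  exact h _ (hB.inter hS) Set.inter_subset_right

theorem continuous_ite_isClopen {Y : Type*} [TopologicalSpace Y] {C : Set X} (hC : IsClopen C)
    [∀ x, Decidable (x ∈ C)] {f g : X → Y} (hf : Continuous f) (hg : Continuous g) :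
    Continuous fun x => if x ∈ C then f x else g x :=
  continuous_if (fun a ha => by
    have : a ∈ frontier C := ha
    rw [hC.frontier_eq] at this
    exact this.elim) hf.continuousOn hg.continuousOn

open Classical in
/-- The map exchanging `C` with `φ g⁻¹ C` and fixing all other points. -/
noncomputable def partialSwap (φ : G →* (X ≃ₜ X)) (g : G) (C : Set X) (x : X) : X :=
  if x ∈ C then φ g⁻¹ x else if x ∈ φ g ⁻¹' C then φ g x else x

section Swap

variable {φ : G →* (X ≃ₜ X)} {g : G} {C U : Set X}

theorem partialSwap_continuous (hC : IsClopen C) : Continuous (partialSwap φ g C) := by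
  classical
  unfold partialSwap
  exact continuous_ite_isClopen hC (φ g⁻¹).continuous
    (continuous_ite_isClopen (hC.preimage (φ g).continuous) (φ g).continuous continuous_id)

theorem partialSwap_involutive (hd : Disjoint C (φ g ⁻¹' C)) :
    Function.Involutive (partialSwap φ g C) := by
  intro x
  have hd' := Set.disjoint_left.1 hd
  by_cases h1 : x ∈ C
  · have h2 : φ g⁻¹ x ∈ φ g ⁻¹' C := by
      rw [Set.mem_preimage, hom_apply_inv_self]; exact h1
    have h3 : φ g⁻¹ x ∉ C := fun h => hd' h h2
    have h4 : partialSwap φ g C x = φ g⁻¹ x := if_pos h1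
    rw [h4, partialSwap, if_neg h3, if_pos h2, hom_apply_inv_self]
  · by_cases h2 : x ∈ φ g ⁻¹' C
    · have h3 : φ g x ∈ C := h2
      have h4 : partialSwap φ g C x = φ g x := by rw [partialSwap, if_neg h1, if_pos h2]
      rw [h4, partialSwap, if_pos h3, hom_inv_apply_self]
    · have h4 : partialSwap φ g C x = x := by rw [partialSwap, if_neg h1, if_neg h2]
      rw [h4, h4]

theorem partialSwap_mapsTo (hCU : C ⊆ U) (hCU' : φ g ⁻¹' C ⊆ U) :
    Set.MapsTo (partialSwap φ g C) U U := by
  intro x hx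
  unfold partialSwap
  split_ifs with h1 h2
  · apply hCU'
    rw [Set.mem_preimage, hom_apply_inv_self]
    exact h1
  · exact hCU h2
  · exact hx

theorem partialSwap_mem_orbitRelOf (x : X) : (x, partialSwap φ g C x) ∈ orbitRelOf φ := by
  unfold partialSwap
  split_ifs
  · exact ⟨g⁻¹, rfl⟩
  · exact ⟨g, rfl⟩
  · exact ⟨1, hom_one_apply φ x⟩

theorem partialSwap_mem_iff (hd : Disjoint C (φ g ⁻¹' C)) {B : Set X} (hB : B ⊆ C) (x : X) :
    partialSwap φ g C x ∈ B ↔ φ g x ∈ B := by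
  have hd' := Set.disjoint_left.1 hd
  by_cases h1 : x ∈ C
  · rw [partialSwap, if_pos h1]
    refine iff_of_false (fun h => hd' (hB h) ?_) fun h => hd' h1 (hB h)
    rw [Set.mem_preimage, hom_apply_inv_self]
    exact h1
  · by_cases h2 : x ∈ φ g ⁻¹' C
    · rw [partialSwap, if_neg h1, if_pos h2]
    · rw [partialSwap, if_neg h1, if_neg h2]
      exact iff_of_false (fun h => h1 (hB h)) fun h => h2 (hB h)

/-- The restriction of `partialSwap` to an invariant set, as a homeomorphism. -/
noncomputable def partialSwapHomeomorph (hC : IsClopen C) (hd : Disjoint C (φ g ⁻¹' C))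
    (hCU : C ⊆ U) (hCU' : φ g ⁻¹' C ⊆ U) : U ≃ₜ U where
  toFun := (partialSwap_mapsTo hCU hCU').restrict
  invFun := (partialSwap_mapsTo hCU hCU').restrict
  left_inv x := Subtype.ext (partialSwap_involutive hd x)
  right_inv x := Subtype.ext (partialSwap_involutive hd x)
  continuous_toFun := (partialSwap_continuous hC).continuousOn.mapsToRestrict _
  continuous_invFun := (partialSwap_continuous hC).continuousOn.mapsToRestrict _

end Swap

variable [MeasurableSpace X] [BorelSpace X]

theorem map_val_preimage_eq_of_disjoint {φ : G →* (X ≃ₜ X)} {U C : Set X} {ν : Measure U}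
    (hν : IsInvariantMeasure (restrictRel (orbitRelOf φ) U) ν) {g : G} (hC : IsClopen C)
    (hd : Disjoint C (φ g ⁻¹' C)) (hCU : C ⊆ U) (hCU' : φ g ⁻¹' C ⊆ U) {B : Set X}
    (hB : MeasurableSet B) (hBC : B ⊆ C) :
    (ν.map Subtype.val) (φ g ⁻¹' B) = (ν.map Subtype.val) B := by
  have key := hν (partialSwapHomeomorph hC hd hCU hCU') fun x => partialSwap_mem_orbitRelOf x.1
  rw [Measure.map_apply measurable_subtype_coe ((φ g).measurable hB),
    Measure.map_apply measurable_subtype_coe hB]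
  conv_rhs => rw [← key]
  rw [Measure.map_apply (partialSwapHomeomorph hC hd hCU hCU').measurable
    (measurable_subtype_coe hB)]
  congr 1
  ext x
  exact (partialSwap_mem_iff hd hBC x.1).symm

/-- An invariant measure on a clopen set is preserved by every partial translation between
subsets of that clopen set. -/
theorem map_val_preimage_eq [CompactSpace X] [T2Space X] [TotallyDisconnectedSpace X]
    {φ : G →* (X ≃ₜ X)} (hfree : IsFreeAction φ) {U : Set X} (hU : IsClopen U) {ν : Measure U}
    (hν : IsInvariantMeasure (restrictRel (orbitRelOf φ) U) ν) (g : G) {B : Set X}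
    (hB : MeasurableSet B) (hBU : B ⊆ U) (hBU' : φ g ⁻¹' B ⊆ U) :
    (ν.map Subtype.val) (φ g ⁻¹' B) = (ν.map Subtype.val) B := by
  by_cases hg : g = 1
  · have : φ g ⁻¹' B = B := by
      ext x
      rw [hg, Set.mem_preimage, hom_one_apply]
    rw [this]
  set T : Set X := U ∩ φ g⁻¹ ⁻¹' U with hT
  have hTc : IsClopen T := hU.inter (hU.preimage (φ g⁻¹).continuous)
  have key : ((ν.map Subtype.val).map (φ g)).restrict T = (ν.map Subtype.val).restrict T := by
    refine hTc.isClosed.isCompact.induction_on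
      (p := fun S => ((ν.map Subtype.val).map (φ g)).restrict S =
        (ν.map Subtype.val).restrict S) (by simp)
      (fun s t hst h => Measure.restrict_congr_mono hst h)
      (fun s t hs ht => Measure.restrict_union_congr.2 ⟨hs, ht⟩) fun x hx => ?_
    have hne : x ≠ φ g⁻¹ x := (hfree g⁻¹ (inv_ne_one.2 hg) x).symm
    obtain ⟨W, W', hW, hW', hxW, hxW', hWW⟩ := t2_separation hne
    obtain ⟨C, hC, hxC, hCsub⟩ := compact_exists_isClopen_in_isOpen
      ((hTc.isOpen.inter hW).inter (hW'.preimage (φ g⁻¹).continuous)) ⟨⟨hx, hxW⟩, hxW'⟩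
    refine ⟨C, mem_nhdsWithin_of_mem_nhds (hC.isOpen.mem_nhds hxC),
      restrict_eq_of_forall_subset hC.isOpen.measurableSet fun D hD hDC => ?_⟩
    rw [Measure.map_apply (φ g).measurable hD]
    refine map_val_preimage_eq_of_disjoint hν hC ?_ (fun y hy => (hCsub hy).1.1.1) ?_ hD hDC
    · refine Set.disjoint_left.2 fun y hy hy' => ?_
      have h := (hCsub hy').2
      rw [Set.mem_preimage, hom_inv_apply_self] at h
      exact Set.disjoint_left.1 hWW (hCsub hy).1.2 h
    · intro y hy
      have h := (hCsub hy).1.1.2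
      rwa [Set.mem_preimage, hom_inv_apply_self] at h
  have hBT : B ⊆ T := fun y hy => ⟨hBU hy, hBU' (by
    rw [Set.mem_preimage, hom_apply_inv_self]; exact hy)⟩
  have h := congrArg (fun m : Measure X => m B) key
  simp only [Measure.restrict_apply hB, Set.inter_eq_left.2 hBT] at h
  rwa [Measure.map_apply (φ g).measurable hB] at h

/-- A measure on a set whose translates cover the space, preserved by partial translations,
extends to the whole space compatibly with all translates. -/
theorem exists_measure_eq_on_translates [Countable G] {φ : G →* (X ≃ₜ X)} {U : Set X}
    (hU : MeasurableSet U) (hcov : ∀ x, ∃ g, φ g x ∈ U) {ν : Measure X}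
    (hν : ∀ g B, MeasurableSet B → B ⊆ U → φ g ⁻¹' B ⊆ U → ν (φ g ⁻¹' B) = ν B) :
    ∃ μ : Measure X, ∀ g B, MeasurableSet B → B ⊆ φ g ⁻¹' U → μ B = ν (φ g⁻¹ ⁻¹' B) := by
  obtain ⟨e, he⟩ := exists_surjective_nat G
  set A : ℕ → Set X := disjointed fun n => φ (e n) ⁻¹' U with hA
  have hAm : ∀ n, MeasurableSet (A n) :=
    MeasurableSet.disjointed fun n => (φ (e n)).measurable hU
  have hAsub : ∀ n, A n ⊆ φ (e n) ⁻¹' U := disjointed_subset _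
  have hAd : Pairwise (Function.onFun Disjoint A) := disjoint_disjointed _
  have hAcov : ⋃ n, A n = Set.univ := by
    rw [hA, iUnion_disjointed, Set.eq_univ_iff_forall]
    intro x
    obtain ⟨g, hg⟩ := hcov x
    obtain ⟨n, rfl⟩ := he g
    exact Set.mem_iUnion.2 ⟨n, hg⟩
  refine ⟨Measure.sum fun n => (ν.map (φ (e n)⁻¹)).restrict (A n), fun g B hB hBU => ?_⟩
  have compat : ∀ k D, MeasurableSet D → D ⊆ φ g ⁻¹' U → D ⊆ φ k ⁻¹' U →
      ν (φ k⁻¹ ⁻¹' D) = ν (φ g⁻¹ ⁻¹' D) := by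
    intro k D hD hDg hDk
    have himg : ∀ l, D ⊆ φ l ⁻¹' U → φ l⁻¹ ⁻¹' D ⊆ U := fun l hl x hx => by
      have := hl hx
      rwa [Set.mem_preimage, hom_apply_inv_self] at this
    have heq : φ (g * k⁻¹) ⁻¹' (φ g⁻¹ ⁻¹' D) = φ k⁻¹ ⁻¹' D := by
      ext x
      simp only [Set.mem_preimage]
      rw [hom_mul_apply, hom_inv_apply_self]
    rw [← heq]
    exact hν _ _ ((φ g⁻¹).measurable hD) (himg g hDg) (heq ▸ himg k hDk)
  have hterm : ∀ n, (ν.map (φ (e n)⁻¹)).restrict (A n) B = (ν.map (φ g⁻¹)) (B ∩ A n) := by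
    intro n
    rw [Measure.restrict_apply hB, Measure.map_apply (φ _).measurable (hB.inter (hAm n)),
      Measure.map_apply (φ _).measurable (hB.inter (hAm n))]
    exact compat _ _ (hB.inter (hAm n)) (Set.inter_subset_left.trans hBU)
      (Set.inter_subset_right.trans (hAsub n))
  rw [Measure.sum_apply _ hB, tsum_congr hterm, ← Measure.map_apply (φ _).measurable hB,
    ← measure_iUnion (fun i j hij => (hAd hij).mono Set.inter_subset_right Set.inter_subset_right)
      fun n => hB.inter (hAm n), ← Set.inter_iUnion, hAcov, Set.inter_univ]

/-- A measure invariant under a countable group action is invariant under its orbit relation. -/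
theorem isInvariantMeasure_of_map_eq [Countable G] [T2Space X] {φ : G →* (X ≃ₜ X)} {μ : Measure X}
    (hμ : ∀ g, μ.map (φ g) = μ) : IsInvariantMeasure (orbitRelOf φ) μ := by
  intro h hh
  have hcov : ⋃ g : G, {y | h.symm y = φ g⁻¹ y} = Set.univ := by
    refine Set.eq_univ_iff_forall.2 fun y => Set.mem_iUnion.2 ?_
    obtain ⟨g, hg⟩ := hh (h.symm y)
    refine ⟨g, ?_⟩
    simp only [h.apply_symm_apply] at hg
    have h1 := hom_inv_apply_self φ g (h.symm y)
    rw [hg] at h1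
    exact h1.symm
  refine (Measure.ext_iff_of_iUnion_eq_univ hcov).2 fun g => restrict_eq_of_forall_subset
    (isClosed_eq h.symm.continuous (φ g⁻¹).continuous).measurableSet fun B hB hBS => ?_
  have heq : h ⁻¹' B = φ g ⁻¹' B := by
    ext x
    constructor
    · intro hx
      have := hBS hx
      rw [Set.mem_ofPred_eq, h.symm_apply_apply] at this
      rw [Set.mem_preimage, this, hom_apply_inv_self]
      exact hx
    · intro hx
      have := hBS hx
      rw [Set.mem_ofPred_eq, hom_inv_apply_self, h.symm_apply_eq] at this
      rw [Set.mem_preimage, ← this]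
      exact hx
  rw [Measure.map_apply h.measurable hB, heq, ← Measure.map_apply (φ g).measurable hB, hμ]

end Extension

/-- For a Cantor minimal `G`-system and a nonempty clopen `U ⊆ X`, every
finite `R|_U`-invariant Borel measure on `U` is the restriction of an `R`-invariant Borel
measure on `X`. -/
theorem statement2 {G : Type*} [Group G] [Countable G] {X : Type*} [TopologicalSpace X] [CompactSpace X]
    [TopologicalSpace.MetrizableSpace X] [TotallyDisconnectedSpace X] [Nonempty X]
    [MeasurableSpace X] [BorelSpace X]
    (hperf : Perfect (Set.univ : Set X))
    (φ : G →* (X ≃ₜ X)) (hfree : IsFreeAction φ) (hmin : IsMinimalRel (orbitRelOf φ))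
    (U : Set X) (hU : IsClopen U) (hUne : U.Nonempty)
    (ν : Measure ↥U) [IsFiniteMeasure ν]
    (hν : IsInvariantMeasure (restrictRel (orbitRelOf φ) U) ν) :
    ∃ μ : Measure X, IsInvariantMeasure (orbitRelOf φ) μ ∧
      ∀ W : Set ↥U, MeasurableSet W → ν W = μ (Subtype.val '' W) := by
  have hcov : ∀ x, ∃ g, φ g x ∈ U := by
    intro x
    obtain ⟨y, hyU, g, hg⟩ := (hmin x).inter_open_nonempty U hU.isOpen hUne
    exact ⟨g, by rw [show φ g x = y from hg]; exact hyU⟩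
  obtain ⟨μ, hμ⟩ := exists_measure_eq_on_translates hU.isOpen.measurableSet hcov
    fun g B hB => map_val_preimage_eq hfree hU hν g hB
  refine ⟨μ, isInvariantMeasure_of_map_eq fun g => ?_, fun W hW => ?_⟩
  · have hcov' : ⋃ k : G, φ k ⁻¹' U = Set.univ :=
      Set.eq_univ_iff_forall.2 fun x => Set.mem_iUnion.2 (hcov x)
    refine (Measure.ext_iff_of_iUnion_eq_univ hcov').2 fun k => restrict_eq_of_forall_subset
      ((φ k).measurable hU.isOpen.measurableSet) fun B hB hBU => ?_
    rw [Measure.map_apply (φ g).measurable hB, hμ k B hB hBU,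
      hμ (k * g) _ ((φ g).measurable hB) fun x hx => ?_]
    · congr 1
      ext x
      simp only [Set.mem_preimage]
      rw [← hom_mul_apply, mul_inv_rev, mul_inv_cancel_left]
    · rw [Set.mem_preimage, hom_mul_apply]
      exact hBU hx
  · have hW' : MeasurableSet (Subtype.val '' W) := hU.isOpen.measurableSet.subtype_image hW
    rw [hμ 1 _ hW' fun x hx => ?_]
    · have : φ 1⁻¹ ⁻¹' (Subtype.val '' W) = Subtype.val '' W := by
        ext x
        rw [Set.mem_preimage, inv_one, hom_one_apply]
      rw [this, Measure.map_apply measurable_subtype_coe hW',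
        Set.preimage_image_eq _ Subtype.val_injective]
    · obtain ⟨y, -, rfl⟩ := hx
      rw [Set.mem_preimage, hom_one_apply]
      exact y.2
end

section
/- Let R_{G,φ} be a Cantor minimal G-system on a Cantor set X with M(R_{G,φ}) ≠ ∅ and let U be a nonempty clopen subset of X. Then the map ψ : D_m(R_{G,φ}|_U) → D_m(R_{G,φ}) determined by ψ([1_W]) = [1_W] for every clopen set W ⊆ U is a well-defined order isomorphism; in particular the triples (D_m(R_{G,φ}|_U), D_m(R_{G,φ}|_U)⁺, [1_U]) and (D_m(R_{G,φ}), D_m(R_{G,φ})⁺, [1_U]) are isomorphic. -/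
open MeasureTheory
open scoped ENNReal

/-- The characteristic function `1_W` of a clopen set, as a continuous `ℤ`-valued map. -/
noncomputable def clopenChar {X : Type*} [TopologicalSpace X] (W : Set X) (hW : IsClopen W) :
    C(X, ℤ) :=
  ⟨Set.indicator W 1, by
    simpa [LocallyConstant.coe_charFn] using (LocallyConstant.charFn ℤ hW).continuous⟩

section MeasureLemmas

lemma measure_ext_of_iUnion_of_subset {X ι : Type*} [MeasurableSpace X] [Countable ι]
    {μ ν : Measure X} {s : ι → Set X} (hs : ⋃ i, s i = Set.univ)
    (hm : ∀ i, MeasurableSet (s i))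
    (h : ∀ i B, MeasurableSet B → B ⊆ s i → μ B = ν B) : μ = ν := by
  refine Measure.ext_of_iUnion_eq_univ hs fun i => ?_
  ext B hB
  rw [Measure.restrict_apply hB, Measure.restrict_apply hB]
  exact h i _ (hB.inter (hm i)) Set.inter_subset_right

/-- A countable group generates its orbit relation measure-theoretically: invariance under the
group implies invariance under every homeomorphism moving points inside orbits. -/
lemma isInvariantMeasure_orbitRelOf {G X : Type*} [Group G] [Countable G] [TopologicalSpace X]
    [T2Space X] [MeasurableSpace X] [BorelSpace X] {φ : G →* (X ≃ₜ X)} {μ : Measure X}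
    (hμ : ∀ g, μ.map (φ g) = μ) : IsInvariantMeasure (orbitRelOf φ) μ := by
  intro h hh
  refine measure_ext_of_iUnion_of_subset (s := fun g : G => {y | h.symm y = (φ g).symm y})
    ?_ (fun g => (isClosed_eq h.symm.continuous (φ g).symm.continuous).measurableSet) ?_
  · refine Set.eq_univ_of_forall fun y => Set.mem_iUnion.2 ?_
    obtain ⟨g, hg⟩ := hh (h.symm y)
    refine ⟨g, ?_⟩
    simp only [Homeomorph.apply_symm_apply] at hg
    exact ((φ g).toEquiv.symm_apply_eq.2 hg.symm).symm
  · intro g B hB hBs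
    rw [Measure.map_apply h.measurable hB]
    conv_rhs => rw [← hμ g, Measure.map_apply (φ g).measurable hB]
    congr 1
    ext x
    simp only [Set.mem_preimage]
    constructor
    · intro hx
      have := hBs hx
      simp only [Set.mem_ofPred_eq, Homeomorph.symm_apply_apply] at this
      rw [this]
      simpa using hx
    · intro hx
      have := hBs hx
      simp only [Set.mem_ofPred_eq, Homeomorph.symm_apply_apply] at this
      rw [← this]
      simpa using hx

lemma IsInvariantMeasure.map_action {G X : Type*} [Group G] [TopologicalSpace X]
    [MeasurableSpace X] {φ : G →* (X ≃ₜ X)} {μ : Measure X}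
    (hμ : IsInvariantMeasure (orbitRelOf φ) μ) (g : G) : μ.map (φ g) = μ :=
  hμ (φ g) fun _ => ⟨g, rfl⟩

lemma integral_eq_zero_of_mem_DmKer {X : Type*} [TopologicalSpace X] [CompactSpace X] [T2Space X]
    [MeasurableSpace X] [OpensMeasurableSpace X] {R : Set (X × X)} {f : C(X, ℤ)}
    (hf : f ∈ DmKer R) (μ : Measure X) [IsFiniteMeasure μ] (hμ : IsInvariantMeasure R μ) :
    ∫ x, ((f x : ℤ) : ℝ) ∂μ = 0 := by
  rcases eq_or_ne μ 0 with rfl | h0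
  · simp
  have : NeZero μ := ⟨h0⟩
  have h := hf ((μ Set.univ)⁻¹ • μ) inferInstance fun h hh => by
    rw [Measure.map_smul, hμ h hh]
  rw [integral_smul_measure, smul_eq_zero] at h
  refine h.resolve_left ?_
  simp [ENNReal.toReal_eq_zero_iff, h0]

lemma neg_add_mem_DmKer {X : Type*} [TopologicalSpace X] [CompactSpace X] [T2Space X]
    [MeasurableSpace X] [OpensMeasurableSpace X] {R : Set (X × X)} {f k : C(X, ℤ)}
    (h : ∀ μ : Measure X, IsProbabilityMeasure μ → IsInvariantMeasure R μ →
      ∫ x, ((f x : ℤ) : ℝ) ∂μ = ∫ x, ((k x : ℤ) : ℝ) ∂μ) : -f + k ∈ DmKer R := by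
  intro μ hp hμ
  simp only [neg_add_eq_sub, ContinuousMap.sub_apply, Int.cast_sub]
  rw [integral_sub (integrable_intCast_comp k μ) (integrable_intCast_comp f μ), h μ hp hμ,
    sub_self]

end MeasureLemmas

section Glue

variable {X : Type*} [TopologicalSpace X]

lemma IsClopen.continuous_of_continuousOn {Y : Type*} [TopologicalSpace Y] {U : Set X}
    (hU : IsClopen U) {f : X → Y} (h₁ : ContinuousOn f U) (h₂ : ContinuousOn f Uᶜ) :
    Continuous f := by
  rw [← continuousOn_univ, ← Set.union_compl_self U]
  exact h₁.union_of_isOpen h₂ hU.isOpen hU.compl.isOpen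

open Classical in
/-- Extension by zero of integer valued functions from a clopen subset. -/
noncomputable def extendZero {U : Set X} (hU : IsClopen U) : C(↥U, ℤ) →+ C(X, ℤ) where
  toFun f := ⟨fun x => if h : x ∈ U then f ⟨x, h⟩ else 0, by
    refine hU.continuous_of_continuousOn ?_ ?_
    · rw [continuousOn_iff_continuous_domRestrict]
      convert f.continuous using 1
      ext x
      simp
    · refine (continuousOn_const (c := (0 : ℤ))).congr fun x hx => ?_
      simp [show x ∉ U from hx]⟩
  map_zero' := by ext x; simp
  map_add' f g := by
    ext x
    by_cases h : x ∈ U <;> simp [h]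

lemma extendZero_apply_coe {U : Set X} (hU : IsClopen U) (f : C(↥U, ℤ)) (u : U) :
    extendZero hU f u = f u := by
  simp [extendZero]

lemma extendZero_apply_of_notMem {U : Set X} (hU : IsClopen U) (f : C(↥U, ℤ)) {x : X}
    (hx : x ∉ U) : extendZero hU f x = 0 := by
  simp [extendZero, hx]

lemma extendZero_nonneg {U : Set X} (hU : IsClopen U) {f : C(↥U, ℤ)} (hf : ∀ u, 0 ≤ f u) (x : X) :
    0 ≤ extendZero hU f x := by
  by_cases hx : x ∈ U
  · exact (extendZero_apply_coe hU f ⟨x, hx⟩).symm ▸ hf _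
  · rw [extendZero_apply_of_notMem hU f hx]

lemma extendZero_clopenChar {U W : Set X} (hU : IsClopen U) (hW : IsClopen W) (hWU : W ⊆ U) :
    extendZero hU (clopenChar ((Subtype.val : ↥U → X) ⁻¹' W)
      (hW.preimage continuous_subtype_val)) = clopenChar W hW := by
  ext x
  by_cases hx : x ∈ U
  · exact extendZero_apply_coe hU _ ⟨x, hx⟩
  · rw [extendZero_apply_of_notMem hU _ hx]
    exact (Set.indicator_of_notMem (fun h => hx (hWU h)) _).symm

open Classical in
/-- Extension by the identity of a self-homeomorphism of a clopen subset. -/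
noncomputable def extendId {U : Set X} (hU : IsClopen U) (h : ↥U ≃ₜ ↥U) : X ≃ₜ X where
  toEquiv := Equiv.Perm.ofSubtype (p := (· ∈ U)) h.toEquiv
  continuous_toFun := by
    refine hU.continuous_of_continuousOn ?_ ?_
    · rw [continuousOn_iff_continuous_domRestrict]
      convert continuous_subtype_val.comp h.continuous using 1
      ext x
      exact Equiv.Perm.ofSubtype_apply_coe (p := (· ∈ U)) h.toEquiv x
    · exact continuousOn_id.congr fun x hx =>
        Equiv.Perm.ofSubtype_apply_of_not_mem (p := (· ∈ U)) h.toEquiv hx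
  continuous_invFun := by
    change Continuous ((Equiv.Perm.ofSubtype (p := (· ∈ U)) h.toEquiv)⁻¹ : Equiv.Perm X)
    rw [← map_inv]
    refine hU.continuous_of_continuousOn ?_ ?_
    · rw [continuousOn_iff_continuous_domRestrict]
      convert continuous_subtype_val.comp h.symm.continuous using 1
      ext x
      exact Equiv.Perm.ofSubtype_apply_coe (p := (· ∈ U)) (h.toEquiv⁻¹ : Equiv.Perm U) x
    · exact continuousOn_id.congr fun x hx =>
        Equiv.Perm.ofSubtype_apply_of_not_mem (p := (· ∈ U)) (h.toEquiv⁻¹ : Equiv.Perm U) hx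

lemma extendId_apply_coe {U : Set X} (hU : IsClopen U) (h : ↥U ≃ₜ ↥U) (u : U) :
    extendId hU h u = h u := by
  classical
  exact Equiv.Perm.ofSubtype_apply_coe (p := (· ∈ U)) h.toEquiv u

lemma extendId_apply_of_notMem {U : Set X} (hU : IsClopen U) (h : ↥U ≃ₜ ↥U) {x : X}
    (hx : x ∉ U) : extendId hU h x = x := by
  classical
  exact Equiv.Perm.ofSubtype_apply_of_not_mem (p := (· ∈ U)) h.toEquiv hx

/-- A homeomorphism exchanging two disjoint clopen subsets of `U` restricts to an involution of
`U` that is the identity off these subsets. -/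
lemma exists_swap_homeomorph {U W : Set X} (α : X ≃ₜ X) (hW : IsClopen W) (hWU : W ⊆ U)
    (hWU' : α ⁻¹' W ⊆ U) (hd : Disjoint W (α ⁻¹' W)) :
    ∃ h : ↥U ≃ₜ ↥U, (∀ u : U, (u : X) ∈ W → (h u : X) = α.symm u) ∧
      (∀ u : U, α u ∈ W → (h u : X) = α u) ∧
      ∀ u : U, (u : X) ∉ W → α u ∉ W → h u = u := by
  classical
  let s : X → X := W.piecewise α.symm ((α ⁻¹' W).piecewise α id)
  have hW' : IsClopen (α ⁻¹' W) := hW.preimage α.continuous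
  have hd' : ∀ x, x ∈ W → α x ∉ W := fun x hx => Set.disjoint_left.1 hd hx
  have hs : Continuous s :=
    Continuous.piecewise (by simp [hW.frontier_eq]) α.symm.continuous
      (Continuous.piecewise (by simp [hW'.frontier_eq]) α.continuous continuous_id)
  have h₁ : ∀ x ∈ W, s x = α.symm x := fun x hx => Set.piecewise_eq_of_mem _ _ _ hx
  have h₂ : ∀ x, α x ∈ W → s x = α x := fun x hx => by
    have hx' : x ∉ W := fun h => hd' x h hx
    simp [s, hx', hx]
  have h₃ : ∀ x, x ∉ W → α x ∉ W → s x = x := fun x hx hx' => by simp [s, hx', hx]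
  have hsU : ∀ x ∈ U, s x ∈ U := by
    intro x hx
    by_cases hxW : x ∈ W
    · rw [h₁ x hxW]
      exact hWU' (by simpa using hxW)
    by_cases hxW' : α x ∈ W
    · rw [h₂ x hxW']
      exact hWU hxW'
    · rwa [h₃ x hxW hxW']
  have hss : ∀ x, s (s x) = x := by
    intro x
    by_cases hxW : x ∈ W
    · rw [h₁ x hxW, h₂ _ (by simpa using hxW), α.apply_symm_apply]
    by_cases hxW' : α x ∈ W
    · rw [h₂ x hxW', h₁ _ hxW', α.symm_apply_apply]
    · rw [h₃ x hxW hxW', h₃ x hxW hxW']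
  have hc : Continuous fun u : U => (⟨s u, hsU u u.2⟩ : U) :=
    (hs.comp continuous_subtype_val).subtype_mk _
  refine ⟨⟨⟨fun u => ⟨s u, hsU u u.2⟩, fun u => ⟨s u, hsU u u.2⟩, fun u => Subtype.ext (hss u),
    fun u => Subtype.ext (hss u)⟩, hc, hc⟩, fun u hu => h₁ u hu, fun u hu => h₂ u hu,
    fun u hu hu' => Subtype.ext (h₃ u hu hu')⟩

end Glue

section Restriction

variable {G X : Type*} [Group G] [TopologicalSpace X] [MeasurableSpace X] [BorelSpace X]

/-- The restriction of an invariant measure to a clopen set is invariant. -/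
lemma IsInvariantMeasure.comap_subtype {φ : G →* (X ≃ₜ X)} {μ : Measure X}
    (hμ : IsInvariantMeasure (orbitRelOf φ) μ) {U : Set X} (hU : IsClopen U) :
    IsInvariantMeasure (restrictRel (orbitRelOf φ) U) (μ.comap ((↑) : U → X)) := by
  intro h hh
  have hm : MeasurableEmbedding ((↑) : U → X) :=
    MeasurableEmbedding.subtype_coe hU.isOpen.measurableSet
  have hinv : μ.map (extendId hU h) = μ := hμ _ fun x => by
    by_cases hx : x ∈ U
    · exact (extendId_apply_coe hU h ⟨x, hx⟩).symm ▸ hh ⟨x, hx⟩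
    · rw [extendId_apply_of_notMem hU h hx]
      exact ⟨1, by rw [map_one]; rfl⟩
  ext B hB
  rw [Measure.map_apply h.measurable hB, hm.comap_apply, hm.comap_apply]
  conv_rhs => rw [← hinv, Measure.map_apply (extendId hU h).measurable (hm.measurableSet_image.2 hB)]
  congr 1
  ext x
  by_cases hx : x ∈ U
  · lift x to U using hx
    simp [extendId_apply_coe]
  · simp [extendId_apply_of_notMem hU h hx, hx]

/-- A measure on a clopen set `U` which is invariant for the restricted relation is preserved by
the group elements, wherever they do not leave `U`. -/
lemma IsInvariantMeasure.map_subtype_preimage [CompactSpace X] [T2Space X]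
    [TotallyDisconnectedSpace X] {φ : G →* (X ≃ₜ X)} (hfree : IsFreeAction φ)
    {U : Set X} (hU : IsClopen U) {ν : Measure U}
    (hν : IsInvariantMeasure (restrictRel (orbitRelOf φ) U) ν) (g : G) {B : Set X}
    (hB : MeasurableSet B) (hBU : B ⊆ U) (hBU' : φ g ⁻¹' B ⊆ U) :
    ν.map (↑) (φ g ⁻¹' B) = ν.map (↑) B := by
  rcases eq_or_ne g 1 with rfl | hg
  · rw [map_one]; rfl
  set V : Set X := U ∩ (φ g).symm ⁻¹' U
  have hVc : IsClopen V := hU.inter (hU.preimage (φ g).symm.continuous)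
  have hlocal : ∀ x : X, ∃ W : Set X, x ∈ W ∧ IsClopen W ∧ Disjoint W (φ g ⁻¹' W) := by
    intro x
    obtain ⟨A, C, hA, hC, hxA, hxC, hAC⟩ := t2_separation (hfree g hg x).symm
    obtain ⟨W, hW, hxW, hWs⟩ := compact_exists_isClopen_in_isOpen
      (hA.inter (hC.preimage (φ g).continuous)) ⟨hxA, hxC⟩
    refine ⟨W, hxW, hW, Set.disjoint_left.2 fun y hy hy' => ?_⟩
    exact Set.disjoint_left.1 hAC (hWs hy').1 (hWs hy).2
  choose W hxW hWc hWd using hlocal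
  obtain ⟨t, ht⟩ := CompactSpace.elim_nhds_subcover W fun x => (hWc x).isOpen.mem_nhds (hxW x)
  have key : ((ν.map (↑)).map (φ g)).restrict V = (ν.map (↑) : Measure X).restrict V := by
    refine measure_ext_of_iUnion_of_subset (s := fun x : t => W x) ?_
      (fun x => (hWc x).isOpen.measurableSet) ?_
    · simpa [Set.iUnion_subtype] using ht
    · intro x C hC hCW
      have hCV : MeasurableSet (C ∩ V) := hC.inter hVc.isOpen.measurableSet
      rw [Measure.restrict_apply hC, Measure.restrict_apply hC,
        Measure.map_apply (φ g).measurable hCV,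
        Measure.map_apply measurable_subtype_coe ((φ g).measurable hCV),
        Measure.map_apply measurable_subtype_coe hCV]
      obtain ⟨h, h₁, h₂, h₃⟩ := exists_swap_homeomorph (U := U) (W := W x ∩ V) (φ g)
        ((hWc x).inter hVc) (fun y hy => hy.2.1)
        (fun y hy => by simpa using hy.2.2)
        ((hWd x).mono Set.inter_subset_left (Set.preimage_mono Set.inter_subset_left))
      have hinv := hν h fun u => by
        by_cases hu : (u : X) ∈ W x ∩ V
        · refine ⟨g⁻¹, ?_⟩
          rw [h₁ u hu, map_inv]; rfl
        by_cases hu' : φ g u ∈ W x ∩ V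
        · exact ⟨g, (h₂ u hu').symm⟩
        · exact ⟨1, by rw [h₃ u hu hu', map_one]; rfl⟩
      conv_rhs => rw [← hinv, Measure.map_apply h.measurable (measurable_subtype_coe hCV)]
      congr 1
      ext u
      have hsub : C ∩ V ⊆ W x ∩ V := Set.inter_subset_inter_left _ hCW
      simp only [Set.mem_preimage]
      by_cases hu' : φ g u ∈ W x ∩ V
      · rw [h₂ u hu']
      refine iff_of_false (fun h => hu' (hsub h)) fun hmem => ?_
      by_cases hu : (u : X) ∈ W x ∩ V
      · rw [h₁ u hu] at hmem
        refine Set.disjoint_left.1 (hWd x) (hsub hmem).1 ?_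
        simpa using hu.1
      · rw [h₃ u hu hu'] at hmem
        exact hu (hsub hmem)
  have hBV : B ⊆ V := fun x hx => ⟨hBU hx, hBU' (by simpa using hx)⟩
  have := congrArg (fun m : Measure X => m B) key
  simpa only [Measure.restrict_eq_self _ hBV, Measure.map_apply (φ g).measurable hB] using this

lemma integral_extendZero {U : Set X} (hU : IsClopen U) (f : C(↥U, ℤ)) (μ : Measure X) :
    ∫ x, ((extendZero hU f x : ℤ) : ℝ) ∂μ = ∫ u, ((f u : ℤ) : ℝ) ∂(μ.comap ((↑) : U → X)) := by
  rw [← setIntegral_eq_integral_of_forall_compl_eq_zero (s := U) fun x hx => by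
    rw [extendZero_apply_of_notMem hU f hx, Int.cast_zero],
    ← integral_subtype_comap hU.isOpen.measurableSet]
  simp only [extendZero_apply_coe]

end Restriction

section Transfer

variable {X ι : Type*} [TopologicalSpace X] [Fintype ι] {P : ι → Set X}

/-- The sum of the translates of `f` restricted to the pieces `P i`, moved by `a i`. -/
noncomputable def transfer (hP : ∀ i, IsClopen (P i)) (a : ι → X ≃ₜ X) (U : Set X) :
    C(X, ℤ) →+ C(↥U, ℤ) where
  toFun f := ⟨fun u => ∑ i, (P i).indicator f ((a i).symm u),
    continuous_finsetSum _ fun i _ =>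
      (f.continuous.indicator (by simp [(hP i).frontier_eq])).comp
        ((a i).symm.continuous.comp continuous_subtype_val)⟩
  map_zero' := by ext u; simp
  map_add' f g := by
    ext u
    simp only [ContinuousMap.coe_mk, ContinuousMap.add_apply, ← Finset.sum_add_distrib]
    exact Finset.sum_congr rfl fun i _ => congrFun (Set.indicator_add (P i) f g) _

lemma transfer_nonneg (hP : ∀ i, IsClopen (P i)) (a : ι → X ≃ₜ X) (U : Set X) {f : C(X, ℤ)}
    (hf : ∀ x, 0 ≤ f x) (u : U) : 0 ≤ transfer hP a U f u :=
  Finset.sum_nonneg fun _ _ => Set.indicator_nonneg (fun x _ => hf x) _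

lemma extendZero_transfer_apply (hP : ∀ i, IsClopen (P i)) (a : ι → X ≃ₜ X) {U : Set X}
    (hU : IsClopen U) (ha : ∀ i, ∀ x ∈ P i, a i x ∈ U) (f : C(X, ℤ)) (x : X) :
    extendZero hU (transfer hP a U f) x = ∑ i, (P i).indicator f ((a i).symm x) := by
  by_cases hx : x ∈ U
  · exact extendZero_apply_coe hU _ ⟨x, hx⟩
  · rw [extendZero_apply_of_notMem hU _ hx]
    refine (Finset.sum_eq_zero fun i _ => Set.indicator_of_notMem (fun h => hx ?_) _).symm
    simpa using ha i _ h

variable [MeasurableSpace X] [BorelSpace X]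

/-- The measure dual to `transfer`. -/
noncomputable def sweep (P : ι → Set X) (a : ι → X ≃ₜ X) (μ : Measure X) : Measure X :=
  ∑ i, (μ.map (a i).symm).restrict (P i)

instance (a : ι → X ≃ₜ X) (μ : Measure X) [IsFiniteMeasure μ] : IsFiniteMeasure (sweep P a μ) := by
  unfold sweep
  infer_instance

lemma integral_sum_indicator [CompactSpace X] [T2Space X] (hP : ∀ i, IsClopen (P i))
    (a : ι → X ≃ₜ X) (f : C(X, ℤ)) (μ : Measure X) [IsFiniteMeasure μ] :
    ∫ x, ((∑ i, (P i).indicator f ((a i).symm x) : ℤ) : ℝ) ∂μ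
      = ∫ x, ((f x : ℤ) : ℝ) ∂(sweep P a μ) := by
  let k (i : ι) : C(X, ℤ) := ⟨fun x => (P i).indicator f ((a i).symm x),
    (f.continuous.indicator (by simp [(hP i).frontier_eq])).comp (a i).symm.continuous⟩
  have hk (i : ι) : Integrable (fun x => (((P i).indicator f ((a i).symm x) : ℤ) : ℝ)) μ :=
    integrable_intCast_comp (k i) μ
  rw [sweep, integral_finsetSum_measure fun i _ => integrable_intCast_comp f _]
  push_cast
  rw [integral_finsetSum _ fun i _ => hk i]
  refine Finset.sum_congr rfl fun i _ => ?_
  rw [← integral_indicator (hP i).isOpen.measurableSet,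
    (a i).symm.measurableEmbedding.integral_map]
  congr 1 with x
  by_cases hx : (a i).symm x ∈ P i <;> simp [hx]

lemma sweep_apply_of_subset (hd : Pairwise (Function.onFun Disjoint P))
    (a : ι → X ≃ₜ X) (μ : Measure X) {i : ι} {B : Set X} (hB : MeasurableSet B) (hBP : B ⊆ P i) :
    sweep P a μ B = μ ((a i).symm ⁻¹' B) := by
  rw [sweep, Measure.finsetSum_apply, Finset.sum_eq_single i]
  · rw [Measure.restrict_eq_self _ hBP, Measure.map_apply (a i).symm.measurable hB]
  · intro j _ hj
    rw [Measure.restrict_apply hB, ((hd hj.symm).mono_left hBP).inter_eq, measure_empty]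
  · simp

end Transfer

section Action

variable {G X : Type*} [Group G] [TopologicalSpace X]

/-- Under a minimal action, the space is cut into finitely many clopen pieces, each of which is
moved into a given nonempty clopen set by a group element. -/
lemma exists_clopen_partition_into [CompactSpace X] {φ : G →* (X ≃ₜ X)} (hmin : IsMinimalRel (orbitRelOf φ))
    {U : Set X} (hU : IsClopen U) (hUne : U.Nonempty) :
    ∃ (n : ℕ) (P : Fin n → Set X) (g : Fin n → G), (∀ i, IsClopen (P i)) ∧
      Pairwise (Function.onFun Disjoint P) ∧ ⋃ i, P i = Set.univ ∧
      ∀ i, ∀ x ∈ P i, φ (g i) x ∈ U := by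
  obtain ⟨t, ht⟩ := isCompact_univ.elim_finite_subcover (fun g : G => φ g ⁻¹' U)
    (fun g => hU.isOpen.preimage (φ g).continuous) fun x _ => by
      obtain ⟨y, hyU, g, hg⟩ := (hmin x).inter_open_nonempty U hU.isOpen hUne
      exact Set.mem_iUnion.2 ⟨g, by simpa [hg] using hyU⟩
  let g (i : Fin t.card) : G := (t.equivFin.symm i : G)
  let V (i : Fin t.card) : Set X := φ (g i) ⁻¹' U
  have hV (i) : IsClopen (V i) := hU.preimage (φ (g i)).continuous
  refine ⟨t.card, disjointed V, g, fun i => ?_, disjoint_disjointed V, ?_,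
    fun i x hx => disjointed_subset V i hx⟩
  · exact disjointedRec (p := IsClopen) (fun _ j h => h.diff (hV j)) (hV i)
  · rw [iUnion_disjointed]
    refine Set.eq_univ_of_forall fun x => ?_
    obtain ⟨k, hk, hx⟩ := Set.mem_iUnion₂.1 (ht (Set.mem_univ x))
    exact Set.mem_iUnion.2 ⟨t.equivFin ⟨k, hk⟩, by simpa [V, g] using hx⟩

variable {ι : Type*} [Fintype ι] [MeasurableSpace X] [BorelSpace X] {P : ι → Set X}
  {φ : G →* (X ≃ₜ X)} {g : ι → G} {U : Set X}

lemma IsInvariantMeasure.sweep_eq (hP : ∀ i, IsClopen (P i))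
    (hd : Pairwise (Function.onFun Disjoint P)) (hcov : ⋃ i, P i = Set.univ) {μ : Measure X}
    (hμ : IsInvariantMeasure (orbitRelOf φ) μ) : sweep P (fun i => φ (g i)) μ = μ := by
  refine measure_ext_of_iUnion_of_subset hcov (fun i => (hP i).isOpen.measurableSet) fun i B hB hBP => ?_
  rw [sweep_apply_of_subset hd _ μ hB hBP]
  conv_rhs => rw [← hμ.map_action (g i)⁻¹, Measure.map_apply (φ _).measurable hB]
  rw [map_inv]
  rfl

variable {μ : Measure X}

lemma sweep_restrict_eq (hP : ∀ i, IsClopen (P i))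
    (hd : Pairwise (Function.onFun Disjoint P)) (hcov : ⋃ i, P i = Set.univ)
    (ha : ∀ i, ∀ x ∈ P i, φ (g i) x ∈ U) (hU : IsClopen U)
    (hμ : ∀ (k : G) (B : Set X), MeasurableSet B → B ⊆ U → φ k ⁻¹' B ⊆ U → μ (φ k ⁻¹' B) = μ B) :
    (sweep P (fun i => φ (g i)) μ).restrict U = μ.restrict U := by
  refine measure_ext_of_iUnion_of_subset hcov (fun i => (hP i).isOpen.measurableSet) fun i B hB hBP => ?_
  have hBU : MeasurableSet (B ∩ U) := hB.inter hU.isOpen.measurableSet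
  rw [Measure.restrict_apply hB, Measure.restrict_apply hB,
    sweep_apply_of_subset hd _ μ hBU (Set.inter_subset_left.trans hBP)]
  have := hμ (g i)⁻¹ (B ∩ U) hBU Set.inter_subset_right
  rw [map_inv] at this
  refine this fun x hx => ?_
  simpa using ha i _ (hBP hx.1)

lemma isInvariantMeasure_sweep [Countable G] [T2Space X] (hP : ∀ i, IsClopen (P i))
    (hd : Pairwise (Function.onFun Disjoint P)) (hcov : ⋃ i, P i = Set.univ)
    (ha : ∀ i, ∀ x ∈ P i, φ (g i) x ∈ U)
    (hμ : ∀ (k : G) (B : Set X), MeasurableSet B → B ⊆ U → φ k ⁻¹' B ⊆ U → μ (φ k ⁻¹' B) = μ B) :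
    IsInvariantMeasure (orbitRelOf φ) (sweep P (fun i => φ (g i)) μ) := by
  refine isInvariantMeasure_orbitRelOf fun k => ?_
  refine measure_ext_of_iUnion_of_subset
    (s := fun p : ι × ι => P p.1 ∩ (φ k).symm ⁻¹' P p.2) ?_
    (fun p => ((hP _).inter ((hP _).preimage (φ k).symm.continuous)).isOpen.measurableSet) ?_
  · refine Set.eq_univ_of_forall fun x => Set.mem_iUnion.2 ?_
    obtain ⟨i, hi⟩ := Set.mem_iUnion.1 (hcov.symm ▸ Set.mem_univ x)
    obtain ⟨j, hj⟩ := Set.mem_iUnion.1 (hcov.symm ▸ Set.mem_univ ((φ k).symm x))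
    exact ⟨(i, j), hi, hj⟩
  · rintro ⟨i, j⟩ B hB hBP
    have hB' : MeasurableSet (φ k ⁻¹' B) := (φ k).measurable hB
    have hj : φ k ⁻¹' B ⊆ P j := fun x hx => by simpa using (hBP hx).2
    have hi : B ⊆ P i := fun x hx => (hBP hx).1
    rw [Measure.map_apply (φ k).measurable hB, sweep_apply_of_subset hd _ μ hB' hj,
      sweep_apply_of_subset hd _ μ hB hi]
    have heq : (φ (g j)).symm ⁻¹' (φ k ⁻¹' B)
        = φ (g i * k * (g j)⁻¹) ⁻¹' ((φ (g i)).symm ⁻¹' B) := by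
      ext x
      simp only [map_mul, map_inv, Set.mem_preimage]
      change _ ↔ (φ (g i)).symm (φ (g i) (φ k ((φ (g j)).symm x))) ∈ B
      rw [Homeomorph.symm_apply_apply]
    rw [heq]
    refine hμ _ _ ((φ (g i)).symm.measurable hB) (fun x hx => ?_) ?_
    · simpa using ha i _ (hi hx)
    · rw [← heq]
      intro x hx
      simpa using ha j _ (hj hx)

end Action

/-- For a Cantor minimal `G`-system with `M(R) ≠ ∅` and a nonempty clopen
`U ⊆ X`, the map `[1_W] ↦ [1_W]` (for clopen `W ⊆ U`) is a well-defined order isomorphism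
`D_m(R|_U) → D_m(R)`; in particular `(D_m(R|_U), D_m(R|_U)⁺, [1_U]) ≅ (D_m(R), D_m(R)⁺, [1_U])`. -/
theorem statement3 {G : Type*} [Group G] [Countable G] {X : Type*} [TopologicalSpace X] [CompactSpace X]
    [TopologicalSpace.MetrizableSpace X] [TotallyDisconnectedSpace X] [Nonempty X]
    [MeasurableSpace X] [BorelSpace X]
    (hperf : Perfect (Set.univ : Set X))
    (φ : G →* (X ≃ₜ X)) (hfree : IsFreeAction φ) (hmin : IsMinimalRel (orbitRelOf φ))
    (hM : ∃ μ : Measure X, IsProbabilityMeasure μ ∧ IsInvariantMeasure (orbitRelOf φ) μ)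
    (U : Set X) (hU : IsClopen U) (hUne : U.Nonempty)
    [CompactSpace ↥U] [BorelSpace ↥U] :
    ∃ ψ : (C(↥U, ℤ) ⧸ DmKer (restrictRel (orbitRelOf φ) U)) ≃+ (C(X, ℤ) ⧸ DmKer (orbitRelOf φ)),
      (⇑ψ '' DmPos (restrictRel (orbitRelOf φ) U) = DmPos (orbitRelOf φ)) ∧
      ∀ (W : Set X) (hW : IsClopen W), W ⊆ U →
        ψ (QuotientAddGroup.mk
            (clopenChar ((Subtype.val : ↥U → X) ⁻¹' W) (hW.preimage continuous_subtype_val)))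
          = QuotientAddGroup.mk (clopenChar W hW) := by
  obtain ⟨n, P, g, hP, hd, hcov, ha⟩ := exists_clopen_partition_into hmin hU hUne
  let E := extendZero hU
  let T := transfer hP (fun i => φ (g i)) U
  have hm : MeasurableEmbedding ((↑) : U → X) :=
    MeasurableEmbedding.subtype_coe hU.isOpen.measurableSet
  have hET (f : C(X, ℤ)) (μ : Measure X) [IsFiniteMeasure μ] :
      ∫ x, ((E (T f) x : ℤ) : ℝ) ∂μ
        = ∫ x, ((f x : ℤ) : ℝ) ∂(sweep P (fun i => φ (g i)) μ) := by
    rw [← integral_sum_indicator hP]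
    simp only [E, T, extendZero_transfer_apply hP _ hU ha]
  have hT (f : C(X, ℤ)) (ν : Measure U) [IsFiniteMeasure ν] :
      ∫ u, ((T f u : ℤ) : ℝ) ∂ν
        = ∫ x, ((f x : ℤ) : ℝ) ∂(sweep P (fun i => φ (g i)) (ν.map (↑))) := by
    rw [← hET, integral_extendZero, hm.comap_map]
  have hEker : DmKer (restrictRel (orbitRelOf φ) U) ≤ (DmKer (orbitRelOf φ)).comap E := by
    intro f hf μ hp hμ
    rw [integral_extendZero]
    exact integral_eq_zero_of_mem_DmKer hf _ (hμ.comap_subtype hU)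
  have hTker : DmKer (orbitRelOf φ) ≤ (DmKer (restrictRel (orbitRelOf φ) U)).comap T := by
    intro f hf ν hp hν
    rw [hT]
    exact integral_eq_zero_of_mem_DmKer hf _ (isInvariantMeasure_sweep hP hd hcov ha
      fun k B hB h₁ h₂ => hν.map_subtype_preimage hfree hU k hB h₁ h₂)
  have hET_sub (f : C(X, ℤ)) : -E (T f) + f ∈ DmKer (orbitRelOf φ) := by
    refine neg_add_mem_DmKer fun μ hp hμ => ?_
    rw [hET, hμ.sweep_eq hP hd hcov]
  have hTE_sub (f : C(↥U, ℤ)) : -T (E f) + f ∈ DmKer (restrictRel (orbitRelOf φ) U) := by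
    refine neg_add_mem_DmKer fun ν hp hν => ?_
    have h₀ (x : X) (hx : x ∉ U) : ((E f x : ℤ) : ℝ) = 0 := by
      rw [extendZero_apply_of_notMem hU f hx, Int.cast_zero]
    rw [hT, ← setIntegral_eq_integral_of_forall_compl_eq_zero h₀,
      sweep_restrict_eq hP hd hcov ha hU
        fun k B hB h₁ h₂ => hν.map_subtype_preimage hfree hU k hB h₁ h₂,
      setIntegral_eq_integral_of_forall_compl_eq_zero h₀, integral_extendZero, hm.comap_map]
  let ψ : (C(↥U, ℤ) ⧸ DmKer (restrictRel (orbitRelOf φ) U)) ≃+ (C(X, ℤ) ⧸ DmKer (orbitRelOf φ)) :=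
    AddMonoidHom.toAddEquiv (QuotientAddGroup.map _ _ E hEker) (QuotientAddGroup.map _ _ T hTker)
      (by
        ext f
        exact QuotientAddGroup.eq.2 (hTE_sub f))
      (by
        ext f
        exact QuotientAddGroup.eq.2 (hET_sub f))
  have hψ (f : C(↥U, ℤ)) : ψ (QuotientAddGroup.mk f) = QuotientAddGroup.mk (E f) := rfl
  refine ⟨ψ, ?_, fun W hW hWU => ?_⟩
  · refine Set.Subset.antisymm ?_ ?_
    · rintro _ ⟨_, ⟨f, hf, rfl⟩, rfl⟩
      exact ⟨E f, extendZero_nonneg hU hf, rfl⟩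
    · rintro _ ⟨f, hf, rfl⟩
      refine ⟨_, ⟨T f, transfer_nonneg hP _ U hf, rfl⟩, ?_⟩
      exact (hψ _).trans (QuotientAddGroup.eq.2 (hET_sub f))
  · rw [hψ]
    exact congrArg _ (extendZero_clopenChar hU hW hWU)
end

section
/- Let R_{G,φ} be a Cantor minimal G-system on a Cantor set X and let U be a nonempty clopen subset of X. Then there exists an injective continuous open map F : X × ℕ → U × ℕ such that for all y₁, y₂ ∈ X × ℕ, (y₁, y₂) ∈ R^∞_{G,φ} if and only if (F(y₁), F(y₂)) ∈ R^∞_{G,φ}. -/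
open MeasureTheory
open scoped ENNReal

/-- The first index at which a locally constant family of predicates holds is a continuous
function of the point. -/
theorem continuous_nat_find_of_isClopen {X : Type*} [TopologicalSpace X] (p : X → ℕ → Prop)
    [∀ x, DecidablePred (p x)] (hex : ∀ x, ∃ n, p x n) (hp : ∀ n, IsClopen {x | p x n}) :
    Continuous fun x => Nat.find (hex x) := by
  rw [continuous_discrete_rng]
  intro k
  have h : (fun x => Nat.find (hex x)) ⁻¹' {k} =
      {x | p x k} ∩ ⋂ m ∈ Finset.range k, {x | p x m}ᶜ := by
    ext x
    simp [Nat.find_eq_iff]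
  rw [h]
  exact (hp k).isOpen.inter (isOpen_biInter_finset fun m _ => (hp m).compl.isOpen)

/-- A continuous map that has a continuous left inverse and open range is open. -/
theorem isOpenMap_of_leftInverse_of_isOpen_range {A B : Type*} [TopologicalSpace A]
    [TopologicalSpace B] {f : A → B} {h : B → A} (hf : Continuous f) (hh : Continuous h)
    (hl : Function.LeftInverse h f) (hr : IsOpen (Set.range f)) : IsOpenMap f :=
  (Topology.IsOpenEmbedding.mk (Topology.IsEmbedding.of_leftInverse hl hh hf) hr).isOpenMap

/-- For a Cantor minimal `G`-system and a nonempty clopen `U ⊆ X`, there is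
an injective continuous open map `F : X × ℕ → U × ℕ` with
`(y₁, y₂) ∈ R^∞ ↔ (F y₁, F y₂) ∈ R^∞`. -/
theorem statement4 {G : Type*} [Group G] [Countable G] {X : Type*} [TopologicalSpace X] [CompactSpace X]
    [TopologicalSpace.MetrizableSpace X] [TotallyDisconnectedSpace X] [Nonempty X]
    (hperf : Perfect (Set.univ : Set X))
    (φ : G →* (X ≃ₜ X)) (hfree : IsFreeAction φ) (hmin : IsMinimalRel (orbitRelOf φ))
    (U : Set X) (hU : IsClopen U) (hUne : U.Nonempty) :
    ∃ F : X × ℕ → ↥U × ℕ, Function.Injective F ∧ Continuous F ∧ IsOpenMap F ∧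
      ∀ y₁ y₂ : X × ℕ, ((y₁, y₂) ∈ natProdRel (orbitRelOf φ) ↔
        ((((F y₁).1 : X), (F y₁).2), (((F y₂).1 : X), (F y₂).2)) ∈ natProdRel (orbitRelOf φ)) := by
  classical
  obtain ⟨g, hg⟩ := exists_surjective_nat G
  have hex : ∀ x, ∃ n, φ (g n) x ∈ U := by
    intro x
    obtain ⟨y, ⟨a, ha⟩, hyU⟩ := (hmin x).exists_mem_open hU.isOpen hUne
    obtain ⟨n, rfl⟩ := hg a
    exact ⟨n, ha ▸ hyU⟩
  let N : X → ℕ := fun x => Nat.find (hex x)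
  have hNU : ∀ x, φ (g (N x)) x ∈ U := fun x => Nat.find_spec (hex x)
  have hN : Continuous N :=
    continuous_nat_find_of_isClopen (fun x n => φ (g n) x ∈ U) hex
      fun n => hU.preimage (φ (g n)).continuous
  have hact : Continuous fun p : X × ℕ => φ (g p.2) p.1 :=
    continuous_prod_of_discrete_right.2 fun n => (φ (g n)).continuous
  have hact' : Continuous fun p : X × ℕ => (φ (g p.2)).symm p.1 :=
    continuous_prod_of_discrete_right.2 fun n => (φ (g n)).symm.continuous
  let F : X × ℕ → ↥U × ℕ := fun y => (⟨φ (g (N y.1)) y.1, hNU y.1⟩, Nat.pair (N y.1) y.2)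
  let H : ↥U × ℕ → X × ℕ := fun z => ((φ (g z.2.unpair.1)).symm z.1, z.2.unpair.2)
  have hF : Continuous F := by
    refine Continuous.prodMk (Continuous.subtype_mk ?_ _) ?_
    · exact hact.comp (continuous_fst.prodMk (hN.comp continuous_fst))
    · exact (continuous_of_discreteTopology (f := fun q : ℕ × ℕ => Nat.pair q.1 q.2)).comp
        ((hN.comp continuous_fst).prodMk continuous_snd)
  have hunpair : Continuous fun z : ↥U × ℕ => z.2.unpair :=
    (continuous_of_discreteTopology (f := Nat.unpair)).comp continuous_snd
  have hH : Continuous H := by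
    refine Continuous.prodMk ?_ (continuous_snd.comp hunpair)
    exact hact'.comp ((continuous_subtype_val.comp continuous_fst).prodMk
      (continuous_fst.comp hunpair))
  have hHF : Function.LeftInverse H F := by
    intro y
    simp [H, F]
  have hrange : Set.range F = {z | N (H z).1 = z.2.unpair.1} := by
    ext z
    constructor
    · rintro ⟨y, rfl⟩
      simp only [Set.mem_ofPred_eq, hHF y]
      simp [F]
    · intro hz
      refine ⟨H z, Prod.ext (Subtype.ext ?_) ?_⟩
      · change φ (g (N (H z).1)) (H z).1 = z.1
        rw [hz]
        exact (φ (g z.2.unpair.1)).apply_symm_apply z.1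
      · change Nat.pair (N (H z).1) (H z).2 = z.2
        rw [hz]
        exact Nat.pair_unpair z.2
  have hopen : IsOpen (Set.range F) := by
    rw [hrange]
    exact (isOpen_discrete {q : ℕ × ℕ | q.1 = q.2}).preimage
      ((hN.comp (continuous_fst.comp hH)).prodMk (continuous_fst.comp hunpair))
  refine ⟨F, hHF.injective, hF, isOpenMap_of_leftInverse_of_isOpen_range hF hH hHF hopen, ?_⟩
  intro y₁ y₂
  have hmul : ∀ (a b : G) (x : X), φ (a * b) x = φ a (φ b x) := fun a b x => by
    rw [map_mul]
    rfl
  have hinv : ∀ (a : G) (x : X), φ a⁻¹ (φ a x) = x := fun a x => by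
    rw [map_inv]
    exact (φ a).symm_apply_apply x
  change (∃ a, φ a y₁.1 = y₂.1) ↔ ∃ a, φ a (φ (g (N y₁.1)) y₁.1) = φ (g (N y₂.1)) y₂.1
  constructor
  · rintro ⟨a, ha⟩
    refine ⟨g (N y₂.1) * a * (g (N y₁.1))⁻¹, ?_⟩
    rw [hmul, hinv, hmul, ha]
  · rintro ⟨a, ha⟩
    refine ⟨(g (N y₂.1))⁻¹ * (a * g (N y₁.1)), ?_⟩
    rw [hmul, hmul, ha, hinv]
end

section
/- (Analogue of Brown's Lemma.) Let R_{G,φ} be a Cantor minimal G-system on a Cantor set X and let U be a nonempty clopen subset of X. Then there exists a homeomorphism Φ of U × ℕ onto X × ℕ such that (Φ × Φ)((R_{G,φ}|_U)^∞) = R^∞_{G,φ} and Φ(U × {1}) = U × {1} ⊆ X × {1}. -/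
open MeasureTheory
open scoped ENNReal

open Set Function Topology

section CantorBernstein

variable {A B : Type*} [TopologicalSpace A] [TopologicalSpace B]

/-- A piecewise homeomorphism built from `f` on an invariant clopen set `E` and from the inverse of
`g` on its complement. -/
theorem exists_homeomorph_of_isClopen {f : A → B} {g : B → A} (hf : IsOpenEmbedding f)
    (hg : IsOpenEmbedding g) {E : Set A} (hE : IsClopen E) (hrange : (range g)ᶜ ⊆ E)
    (hmaps : ∀ a ∈ E, g (f a) ∈ E) (hback : ∀ b, g b ∈ E → ∃ a ∈ E, f a = b) :
    ∃ Φ : A ≃ₜ B, (∀ a ∈ E, Φ a = f a) ∧ ∀ a ∉ E, g (Φ a) = a := by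
  classical
  have hinv : ∀ a, ∃ b, a ∉ E → g b = a := fun a => by
    by_cases ha : a ∈ E
    · exact ⟨f a, fun h => absurd ha h⟩
    · obtain ⟨b, hb⟩ := not_not.1 fun h => ha (hrange h)
      exact ⟨b, fun _ => hb⟩
  choose r hr using hinv
  let F : A → B := fun a => if a ∈ E then f a else r a
  have hF₁ : ∀ a ∈ E, F a = f a := fun a ha => if_pos ha
  have hF₂ : ∀ a ∉ E, g (F a) = a := fun a ha => by
    rw [show F a = r a from if_neg ha, hr a ha]
  have hinj : Injective F := by
    intro a a' h
    by_cases ha : a ∈ E <;> by_cases ha' : a' ∈ E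
    · exact hf.injective (by rw [← hF₁ a ha, h, hF₁ a' ha'])
    · refine absurd ?_ ha'
      rw [← hF₂ a' ha', ← h, hF₁ a ha]
      exact hmaps a ha
    · refine absurd ?_ ha
      rw [← hF₂ a ha, h, hF₁ a' ha']
      exact hmaps a' ha'
    · rw [← hF₂ a ha, h, hF₂ a' ha']
  have hsurj : Surjective F := by
    intro b
    by_cases hb : g b ∈ E
    · obtain ⟨a, ha, rfl⟩ := hback b hb
      exact ⟨a, hF₁ a ha⟩
    · exact ⟨g b, hg.injective (hF₂ _ hb)⟩
  have hcont : Continuous F := by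
    refine continuous_def.2 fun V hV => ?_
    have : F ⁻¹' V = (E ∩ f ⁻¹' V) ∪ (Eᶜ ∩ g '' V) := by
      ext a
      by_cases ha : a ∈ E
      · simp [ha, hF₁ a ha]
      · simp only [mem_preimage, mem_union, mem_inter_iff, ha, false_and, mem_compl_iff,
          not_false_eq_true, true_and, false_or]
        rw [← hg.injective.mem_set_image, hF₂ a ha]
    rw [this]
    exact (hE.isOpen.inter (hV.preimage hf.continuous)).union
      (hE.compl.isOpen.inter (hg.isOpenMap V hV))
  have hopen : IsOpenMap F := by
    intro W hW
    have : F '' W = f '' (W ∩ E) ∪ g ⁻¹' (W \ E) := by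
      ext b
      constructor
      · rintro ⟨a, ha, rfl⟩
        by_cases haE : a ∈ E
        · exact Or.inl ⟨a, ⟨ha, haE⟩, (hF₁ a haE).symm⟩
        · refine Or.inr ?_
          rw [mem_preimage, hF₂ a haE]
          exact ⟨ha, haE⟩
      · rintro (⟨a, ⟨ha, haE⟩, rfl⟩ | ⟨hb, hbE⟩)
        · exact ⟨a, ha, hF₁ a haE⟩
        · exact ⟨g b, hb, hg.injective (hF₂ _ hbE)⟩
    rw [this]
    exact (hf.isOpenMap _ (hW.inter hE.isOpen)).union
      ((hW.sdiff hE.isClosed).preimage hg.continuous)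
  exact ⟨(Equiv.ofBijective F ⟨hinj, hsurj⟩).toHomeomorphOfContinuousOpen hcont hopen, hF₁, hF₂⟩

/-- A topological Cantor–Bernstein theorem: two clopen embeddings whose composition strictly
increases a continuous `ℕ`-valued level can be combined into a homeomorphism. -/
theorem exists_homeomorph_of_level_lt {f : A → B} {g : B → A} (hf : IsOpenEmbedding f)
    (hf' : IsClosed (range f)) (hg : IsOpenEmbedding g) (hg' : IsClosed (range g))
    {l : A → ℕ} (hl : Continuous l) (hlt : ∀ a, l a < l (g (f a))) :
    ∃ Φ : A ≃ₜ B, (∀ a ∉ range g, Φ a = f a) ∧ ∀ a, Φ a = f a ∨ g (Φ a) = a := by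
  have ho : ∀ n, IsOpenMap (g ∘ f)^[n] := fun n => by
    induction n with
    | zero => exact .id
    | succ n ih => exact ih.comp (hg.isOpenMap.comp hf.isOpenMap)
  have hc : ∀ n, IsClosedMap (g ∘ f)^[n] := fun n => by
    induction n with
    | zero => exact .id
    | succ n ih =>
      exact ih.comp ((IsClosedEmbedding.mk hg.isEmbedding hg').isClosedMap.comp
        (IsClosedEmbedding.mk hf.isEmbedding hf').isClosedMap)
  have hlevel : ∀ n a, n ≤ l ((g ∘ f)^[n] a) := fun n a => by
    induction n with
    | zero => exact Nat.zero_le _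
    | succ n ih =>
      rw [iterate_succ_apply']
      exact ih.trans_lt (hlt _)
  let S : ℕ → Set A := fun n => (g ∘ f)^[n] '' (range g)ᶜ
  have hfin : LocallyFinite S := fun a => by
    refine ⟨l ⁻¹' {l a}, ((isOpen_discrete _).preimage hl).mem_nhds rfl,
      (finite_le_nat (l a)).subset ?_⟩
    rintro n ⟨_, ⟨a', _, rfl⟩, h⟩
    exact (hlevel n a').trans_eq h
  have hclopen : IsClopen (⋃ n, S n) :=
    ⟨hfin.isClosed_iUnion fun n => hc n _ hg.isOpen_range.isClosed_compl,
      isOpen_iUnion fun n => ho n _ hg'.isOpen_compl⟩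
  have hrange : (range g)ᶜ ⊆ ⋃ n, S n := fun a ha => mem_iUnion.2 ⟨0, a, ha, rfl⟩
  obtain ⟨Φ, h₁, h₂⟩ := exists_homeomorph_of_isClopen hf hg hclopen hrange
    (fun a ha => by
      obtain ⟨n, a', ha', rfl⟩ := mem_iUnion.1 ha
      exact mem_iUnion.2 ⟨n + 1, a', ha', iterate_succ_apply' _ _ _⟩)
    (fun b hb => by
      obtain ⟨n, a, ha, h⟩ := mem_iUnion.1 hb
      cases n with
      | zero => exact absurd ⟨b, h.symm⟩ ha
      | succ n =>
        rw [iterate_succ_apply'] at h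
        exact ⟨_, mem_iUnion.2 ⟨n, a, ha, rfl⟩, hg.injective h⟩)
  refine ⟨Φ, fun a ha => h₁ a (hrange ha), fun a => ?_⟩
  by_cases ha : a ∈ ⋃ n, S n
  · exact Or.inl (h₁ a ha)
  · exact Or.inr (h₂ a ha)

end CantorBernstein

section OrbitRelation

variable {X : Type*} [TopologicalSpace X] {G : Type*} [Group G] (φ : G →* (X ≃ₜ X))

theorem mem_orbitRelOf {x y : X} : (x, y) ∈ orbitRelOf φ ↔ ∃ g : G, φ g x = y :=
  Iff.rfl

theorem orbitRelOf_symm {x y : X} (h : (x, y) ∈ orbitRelOf φ) : (y, x) ∈ orbitRelOf φ := by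
  obtain ⟨g, rfl⟩ := (mem_orbitRelOf φ).1 h
  refine ⟨g⁻¹, ?_⟩
  rw [map_inv]
  exact (φ g).symm_apply_apply x

theorem orbitRelOf_trans {x y z : X} (h : (x, y) ∈ orbitRelOf φ) (h' : (y, z) ∈ orbitRelOf φ) :
    (x, z) ∈ orbitRelOf φ := by
  obtain ⟨g, rfl⟩ := (mem_orbitRelOf φ).1 h
  obtain ⟨g', rfl⟩ := (mem_orbitRelOf φ).1 h'
  refine ⟨g' * g, ?_⟩
  rw [map_mul]
  rfl

theorem orbitRelOf_congr {x x' y y' : X} (hx : (x, x') ∈ orbitRelOf φ)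
    (hy : (y, y') ∈ orbitRelOf φ) : (x, y) ∈ orbitRelOf φ ↔ (x', y') ∈ orbitRelOf φ :=
  ⟨fun h => orbitRelOf_trans φ (orbitRelOf_symm φ hx) (orbitRelOf_trans φ h hy),
    fun h => orbitRelOf_trans φ hx (orbitRelOf_trans φ h (orbitRelOf_symm φ hy))⟩

end OrbitRelation

section Embedding

variable {X : Type*} [TopologicalSpace X] {U : Set X}

/-- If the translates of a clopen set `U` under the inverses of a sequence of homeomorphisms cover
the space, some member of the sequence moves each point into `U`, continuously in the point. -/
theorem exists_continuous_index (ψ : ℕ → X ≃ₜ X) (hU : IsClopen U) (hψ : ∀ x, ∃ n, ψ n x ∈ U) :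
    ∃ k : X → ℕ, Continuous k ∧ ∀ x, ψ (k x) x ∈ U := by
  classical
  refine ⟨fun x => Nat.find (hψ x), ?_, fun x => Nat.find_spec (hψ x)⟩
  refine continuous_discrete_rng.2 fun n => ?_
  have : (fun x => Nat.find (hψ x)) ⁻¹' {n} = ψ n ⁻¹' U ∩ ⋂ m ∈ Finset.range n, ψ m ⁻¹' Uᶜ := by
    ext x
    simp [Nat.find_eq_iff]
  rw [this]
  exact (hU.isOpen.preimage (ψ n).continuous).inter
    (isOpen_biInter_finset fun m _ => hU.compl.isOpen.preimage (ψ m).continuous)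

/-- The self-embedding of `X × ℕ` into `U × ℕ` moving a point `x` by `ψ (k x)` and recording
`k x` in the second coordinate, which is at least `2`. -/
def stackMap (ψ : ℕ → X ≃ₜ X) (k : X → ℕ) (hk : ∀ x, ψ (k x) x ∈ U) (p : X × ℕ) : U × ℕ :=
  (⟨ψ (k p.1) p.1, hk p.1⟩, Nat.pair p.2 (k p.1) + 2)

/-- A left inverse of `stackMap`. -/
def unstackMap (ψ : ℕ → X ≃ₜ X) (q : U × ℕ) : X × ℕ :=
  ((ψ (Nat.unpair (q.2 - 2)).2).symm q.1, (Nat.unpair (q.2 - 2)).1)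

theorem continuous_apply_index {Y : Type*} [TopologicalSpace Y] (ψ : ℕ → X ≃ₜ X) {m : Y → ℕ}
    {x : Y → X} (hm : Continuous m) (hx : Continuous x) : Continuous fun y => ψ (m y) (x y) :=
  (continuous_prod_of_discrete_left.2 fun n => (ψ n).continuous :
    Continuous fun p : ℕ × X => ψ p.1 p.2).comp (hm.prodMk hx)

theorem isOpenEmbedding_stackMap (ψ : ℕ → X ≃ₜ X) {k : X → ℕ} (hkc : Continuous k)
    (hk : ∀ x, ψ (k x) x ∈ U) :
    IsOpenEmbedding (stackMap ψ k hk) ∧ IsClosed (range (stackMap ψ k hk)) := by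
  have hleft : LeftInverse (unstackMap ψ) (stackMap ψ k hk) := fun p => by
    simp [stackMap, unstackMap]
  have hk₁ : Continuous fun p : X × ℕ => k p.1 := hkc.comp continuous_fst
  have hcont : Continuous (stackMap ψ k hk) :=
    ((continuous_apply_index ψ hk₁ continuous_fst).subtype_mk _).prodMk
      ((continuous_of_discreteTopology (f := fun p : ℕ × ℕ => Nat.pair p.1 p.2 + 2)).comp
        (continuous_snd.prodMk hk₁))
  have hu : ∀ f : ℕ → ℕ, Continuous fun q : U × ℕ => f q.2 := fun f =>
    continuous_of_discreteTopology.comp continuous_snd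
  have hcont' : Continuous (unstackMap (U := U) ψ) :=
    (continuous_apply_index (fun n => (ψ n).symm) (hu fun n => (Nat.unpair (n - 2)).2)
      (continuous_subtype_val.comp continuous_fst)).prodMk (hu fun n => (Nat.unpair (n - 2)).1)
  let C : Set (U × ℕ) :=
    {q | 2 ≤ q.2} ∩ {q | k (unstackMap ψ q).1 = (Nat.unpair (q.2 - 2)).2}
  have hC : IsClopen C :=
    ((isClopen_discrete {n : ℕ | 2 ≤ n}).preimage continuous_snd).inter
      ((isClopen_discrete {p : ℕ × ℕ | p.1 = p.2}).preimage
        ((hkc.comp (continuous_fst.comp hcont')).prodMk (hu fun n => (Nat.unpair (n - 2)).2)))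
  have hright : ∀ q ∈ C, stackMap ψ k hk (unstackMap ψ q) = q := by
    rintro ⟨u, n⟩ ⟨hn, hq⟩
    have hn : 2 ≤ n := hn
    refine Prod.ext (Subtype.ext ?_) ?_
    · simp only [stackMap]
      rw [hq]
      simp [unstackMap]
    · simp only [stackMap]
      rw [hq]
      simp [unstackMap, Nat.sub_add_cancel hn]
  have hmem : ∀ p, stackMap ψ k hk p ∈ C := fun p =>
    ⟨Nat.le_add_left _ _, by rw [mem_ofPred_eq, hleft p]; simp [stackMap]⟩
  have himage : ∀ W, stackMap ψ k hk '' W = C ∩ unstackMap ψ ⁻¹' W := fun W => by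
    ext q
    constructor
    · rintro ⟨p, hp, rfl⟩
      exact ⟨hmem p, by rwa [mem_preimage, hleft p]⟩
    · rintro ⟨hq, hW⟩
      exact ⟨_, hW, hright q hq⟩
  refine ⟨.of_continuous_injective_isOpenMap hcont hleft.injective fun W hW => ?_, ?_⟩
  · rw [himage]
    exact hC.isOpen.inter (hW.preimage hcont')
  · rw [← image_univ, himage, preimage_univ, inter_univ]
    exact hC.isClosed

end Embedding

/-- **analogue of Brown's Lemma.** For a Cantor minimal `G`-system and a nonempty
clopen `U ⊆ X`, there is a homeomorphism `Φ : U × ℕ → X × ℕ` with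
`(Φ × Φ)((R|_U)^∞) = R^∞` and `Φ(U × {1}) = U × {1} ⊆ X × {1}`. -/
theorem statement5 {G : Type*} [Group G] [Countable G] {X : Type*} [TopologicalSpace X] [CompactSpace X]
    [TopologicalSpace.MetrizableSpace X] [TotallyDisconnectedSpace X] [Nonempty X]
    (hperf : Perfect (Set.univ : Set X))
    (φ : G →* (X ≃ₜ X)) (hfree : IsFreeAction φ) (hmin : IsMinimalRel (orbitRelOf φ))
    (U : Set X) (hU : IsClopen U) (hUne : U.Nonempty) :
    ∃ Φ : ↥U × ℕ ≃ₜ X × ℕ,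
      (∀ z w : ↥U × ℕ, ((z, w) ∈ natProdRel (restrictRel (orbitRelOf φ) U) ↔
        (Φ z, Φ w) ∈ natProdRel (orbitRelOf φ))) ∧
      (⇑Φ '' {z : ↥U × ℕ | z.2 = 1} = {w : X × ℕ | w.1 ∈ U ∧ w.2 = 1}) := by
  obtain ⟨e, he⟩ := exists_surjective_nat G
  let ψ : ℕ → X ≃ₜ X := fun n => φ (e n)
  have hψ : ∀ x, ∃ n, ψ n x ∈ U := fun x => by
    obtain ⟨y, hy, hxy⟩ := (hmin x).inter_open_nonempty U hU.isOpen hUne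
    obtain ⟨g, rfl⟩ := (mem_orbitRelOf φ).1 hxy
    obtain ⟨n, rfl⟩ := he g
    exact ⟨n, hy⟩
  obtain ⟨k, hkc, hk⟩ := exists_continuous_index ψ hU hψ
  obtain ⟨hg, hg'⟩ := isOpenEmbedding_stackMap ψ hkc hk
  have hf : IsOpenEmbedding (Prod.map (Subtype.val : U → X) (id : ℕ → ℕ)) :=
    hU.isOpen.isOpenEmbedding_subtypeVal.prodMap .id
  have hf' : IsClosed (range (Prod.map (Subtype.val : U → X) (id : ℕ → ℕ))) := by
    rw [range_prodMap, Subtype.range_coe, range_id]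
    exact hU.isClosed.prod isClosed_univ
  obtain ⟨Φ, h₁, h₂⟩ := exists_homeomorph_of_level_lt hf hf' hg hg' (l := Prod.snd) continuous_snd
    fun a => Nat.lt_add_of_pos_right two_pos |>.trans_le'
      (Nat.left_le_pair _ _)
  have hΦ : ∀ z, ((z.1 : X), (Φ z).1) ∈ orbitRelOf φ := fun z => by
    rcases h₂ z with h | h
    · exact ⟨1, by rw [h, map_one]; rfl⟩
    · exact orbitRelOf_symm φ ⟨e (k (Φ z).1), congrArg (fun q : U × ℕ => (q.1 : X)) h⟩
  have hfix : ∀ u : U, Φ (u, 1) = (↑u, 1) := fun u => h₁ _ <| by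
    rintro ⟨p, hp⟩
    have : Nat.pair p.2 (k p.1) + 2 = 1 := congrArg Prod.snd hp
    omega
  refine ⟨Φ, fun z w => orbitRelOf_congr φ (hΦ z) (hΦ w), ?_⟩
  ext ⟨x, i⟩
  constructor
  · rintro ⟨⟨u, n⟩, rfl, h⟩
    rw [hfix] at h
    cases h
    exact ⟨u.2, rfl⟩
  · rintro ⟨hx, rfl⟩
    exact ⟨(⟨x, hx⟩, 1), rfl, hfix _⟩
end
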